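/- arXiv:1408.0159 — 3 statements merged into one kernel-verified Lean document; each statement's English description precedes it below -/
import Mathlib

section
/- Let φ₁, φ₂ : ℝⁿ × (0,∞) → (0,∞) satisfy the doubling condition (D), let Φ₁*(x,r) = ∫₁^{max(2,|x|,r)} φ₁(0,t)/t dt and Φ₁**(x,r) = ∫_r^{max(2,|x|,r)} φ₁(x,t)/t dt, and set φ₃ = φ₂/(Φ₁* + Φ₁**). Let 1 ≤ p₂ < p₁ < ∞ and p₄ ≥ p₁p₂/(p₁ − p₂). Then every g ∈ 𝓛𝓝_{p₂,φ₃}(ℝⁿ) ∩ L_{p₄,φ₂/φ₁}(ℝⁿ) is a pointwise multiplier from 𝓛𝓝_{p₁,φ₁}(ℝⁿ) to 𝓛𝓝_{p₂,φ₂}(ℝⁿ); moreover there is a constant C, independent of g, such that ‖fg‖_{𝓛𝓝_{p₂,φ₂}} ≤ C(‖g‖_{𝓛_{p₂,φ₃}} + ‖g‖_{L_{p₄,φ₂/φ₁}}) ‖f‖_{𝓛𝓝_{p₁,φ₁}} for all f ∈ 𝓛𝓝_{p₁,φ₁}(ℝⁿ). -/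
open MeasureTheory Metric Filter
open scoped ENNReal NNReal

noncomputable section

/-- Average of `f` over the ball `B(x,r)`. -/
def ballAvg {n : ℕ} (f : EuclideanSpace ℝ (Fin n) → ℝ) (x : EuclideanSpace ℝ (Fin n))
    (r : ℝ) : ℝ :=
  (volume (ball x r)).toReal⁻¹ * ∫ y in ball x r, f y

/-- Campanato seminorm with variable growth function `φ`. -/
def campSemi {n : ℕ} (p : ℝ) (φ : EuclideanSpace ℝ (Fin n) → ℝ → ℝ)
    (f : EuclideanSpace ℝ (Fin n) → ℝ) : ℝ≥0∞ :=
  ⨆ (x : EuclideanSpace ℝ (Fin n)) (r : ℝ) (_ : 0 < r),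
    ENNReal.ofReal ((φ x r)⁻¹ *
      ((volume (ball x r)).toReal⁻¹ * ∫ y in ball x r, |f y - ballAvg f x r| ^ p) ^ (1 / p))

/-- Campanato norm: seminorm plus `|f_{B(0,1)}|`. -/
def campNorm {n : ℕ} (p : ℝ) (φ : EuclideanSpace ℝ (Fin n) → ℝ → ℝ)
    (f : EuclideanSpace ℝ (Fin n) → ℝ) : ℝ≥0∞ :=
  campSemi p φ f + ENNReal.ofReal |ballAvg f 0 1|

/-- Morrey norm with variable growth function `φ`. -/
def morreyNorm {n : ℕ} (p : ℝ) (φ : EuclideanSpace ℝ (Fin n) → ℝ → ℝ)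
    (f : EuclideanSpace ℝ (Fin n) → ℝ) : ℝ≥0∞ :=
  ⨆ (x : EuclideanSpace ℝ (Fin n)) (r : ℝ) (_ : 0 < r),
    ENNReal.ofReal ((φ x r)⁻¹ *
      ((volume (ball x r)).toReal⁻¹ * ∫ y in ball x r, |f y| ^ p) ^ (1 / p))

/-- Hölder seminorm with variable growth function `φ`. -/
def holderSemi {n : ℕ} (φ : EuclideanSpace ℝ (Fin n) → ℝ → ℝ)
    (f : EuclideanSpace ℝ (Fin n) → ℝ) : ℝ≥0∞ :=
  ⨆ (x : EuclideanSpace ℝ (Fin n)) (y : EuclideanSpace ℝ (Fin n)) (_ : x ≠ y),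
    ENNReal.ofReal (2 * |f x - f y| / (φ x (dist x y) + φ y (dist x y)))

/-- The doubling condition (D) with constant `A`. -/
def DoublingWith {n : ℕ} (A : ℝ) (φ : EuclideanSpace ℝ (Fin n) → ℝ → ℝ) : Prop :=
  ∀ (x : EuclideanSpace ℝ (Fin n)) (r s : ℝ), 0 < r → 0 < s →
    1 / 2 ≤ s / r → s / r ≤ 2 → A⁻¹ ≤ φ x s / φ x r ∧ φ x s / φ x r ≤ A

/-- The doubling condition (D). -/
def Doubling {n : ℕ} (φ : EuclideanSpace ℝ (Fin n) → ℝ → ℝ) : Prop :=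
  ∃ A > 0, DoublingWith A φ

/-- The nearness condition (N). -/
def Nearness {n : ℕ} (φ : EuclideanSpace ℝ (Fin n) → ℝ → ℝ) : Prop :=
  ∃ A > 0, ∀ (x y : EuclideanSpace ℝ (Fin n)) (r : ℝ), 0 < r → dist x y ≤ r →
    A⁻¹ ≤ φ x r / φ y r ∧ φ x r / φ y r ≤ A

/-- The almost increasing condition (I). -/
def AlmostIncreasing {n : ℕ} (φ : EuclideanSpace ℝ (Fin n) → ℝ → ℝ) : Prop :=
  ∃ A > 0, ∀ (x : EuclideanSpace ℝ (Fin n)) (r s : ℝ), 0 < r → r < s → φ x r ≤ A * φ x s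

/-- Positivity of the variable growth function. -/
def GrowthPos {n : ℕ} (φ : EuclideanSpace ℝ (Fin n) → ℝ → ℝ) : Prop :=
  ∀ (x : EuclideanSpace ℝ (Fin n)) (r : ℝ), 0 < r → 0 < φ x r

/-- `f ∈ L^p_loc(ℝⁿ)` (in particular `f ∈ L¹_loc`). -/
def MemLpLoc {n : ℕ} (p : ℝ) (f : EuclideanSpace ℝ (Fin n) → ℝ) : Prop :=
  LocallyIntegrable f volume ∧
    ∀ (x : EuclideanSpace ℝ (Fin n)) (r : ℝ), 0 < r →
      IntegrableOn (fun y => |f y| ^ p) (ball x r) volume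


/-- `Φ*(x,r) = ∫₁^{max(2,|x|,r)} φ(0,t)/t dt`. -/
def PhiStar {n : ℕ} (φ : EuclideanSpace ℝ (Fin n) → ℝ → ℝ)
    (x : EuclideanSpace ℝ (Fin n)) (r : ℝ) : ℝ :=
  ∫ t in (1 : ℝ)..(max 2 (max ‖x‖ r)), φ 0 t / t

/-- `Φ**(x,r) = ∫_r^{max(2,|x|,r)} φ(x,t)/t dt`. -/
def PhiStarStar {n : ℕ} (φ : EuclideanSpace ℝ (Fin n) → ℝ → ℝ)
    (x : EuclideanSpace ℝ (Fin n)) (r : ℝ) : ℝ :=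
  ∫ t in r..(max 2 (max ‖x‖ r)), φ x t / t

section generic

variable {α : Type*} [MeasurableSpace α] {μ : Measure α} [IsProbabilityMeasure μ]

lemma abs_integral_le_eLp {h : α → ℝ} {p : ℝ≥0∞} (hp : 1 ≤ p) (hh : MemLp h p μ) :
    ‖∫ a, h a ∂μ‖ₑ ≤ eLpNorm h p μ := by
  calc ‖∫ a, h a ∂μ‖ₑ ≤ ∫⁻ a, ‖h a‖ₑ ∂μ := enorm_integral_le_lintegral_enorm _
    _ = eLpNorm h 1 μ := eLpNorm_one_eq_lintegral_enorm.symm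
    _ ≤ _ := eLpNorm_le_eLpNorm_of_exponent_le hp hh.1

lemma eLp_const (c : ℝ) {p : ℝ≥0∞} (hp : 1 ≤ p) : eLpNorm (fun _ : α => c) p μ = ‖c‖ₑ := by
  rw [eLpNorm_const c (by positivity) (IsProbabilityMeasure.ne_zero μ)]
  simp

lemma eLp_osc_le {h : α → ℝ} {p : ℝ≥0∞} (hp : 1 ≤ p) (hh : MemLp h p μ) (e : ℝ) :
    eLpNorm (fun x => h x - ∫ a, h a ∂μ) p μ ≤ 2 * eLpNorm (fun x => h x - e) p μ := by
  have hi : Integrable h μ := hh.integrable hp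
  have hhe : MemLp (fun x => h x - e) p μ := hh.sub (memLp_const e)
  have h1 : (fun x => h x - ∫ a, h a ∂μ) =
      (fun x => h x - e) - (fun _ => ∫ a, (h a - e) ∂μ) := by
    funext x
    simp [integral_sub hi (integrable_const e)]
  rw [h1, two_mul]
  refine (eLpNorm_sub_le hhe.1 aestronglyMeasurable_const hp).trans ?_
  gcongr
  rw [eLp_const _ hp]
  exact abs_integral_le_eLp hp hhe

lemma core_holder {f g : α → ℝ} {p₁ p₂ p₄ : ℝ} (hp₂ : 1 ≤ p₂) (hp₁ : p₂ < p₁)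
    (hp₄ : p₁ * p₂ / (p₁ - p₂) ≤ p₄)
    (hf : MemLp f (ENNReal.ofReal p₁) μ) (hg : MemLp g (ENNReal.ofReal p₄) μ) :
    MemLp (fun x => f x * g x) (ENNReal.ofReal p₂) μ ∧
    eLpNorm (fun x => f x * g x) (ENNReal.ofReal p₂) μ ≤
      eLpNorm f (ENNReal.ofReal p₁) μ * eLpNorm g (ENNReal.ofReal p₄) μ := by
  have hd : 0 < p₁ - p₂ := by linarith
  have hp1 : 0 < p₁ := by linarith
  have hp2 : 0 < p₂ := by linarith
  have hq : 0 < p₁ * p₂ / (p₁ - p₂) := by positivity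
  have : ENNReal.HolderTriple (ENNReal.ofReal p₁) (ENNReal.ofReal (p₁ * p₂ / (p₁ - p₂)))
      (ENNReal.ofReal p₂) := by
    constructor
    rw [← ENNReal.ofReal_inv_of_pos hp1, ← ENNReal.ofReal_inv_of_pos hp2,
      ← ENNReal.ofReal_inv_of_pos hq, ← ENNReal.ofReal_add (by positivity) (by positivity)]
    congr 1
    field_simp
    ring
  have hle := ENNReal.ofReal_le_ofReal hp₄
  refine ⟨(hg.mono_exponent hle).mul hf, ?_⟩
  calc _ ≤ eLpNorm f (ENNReal.ofReal p₁) μ *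
        eLpNorm g (ENNReal.ofReal (p₁ * p₂ / (p₁ - p₂))) μ :=
        eLpNorm_smul_le_mul_eLpNorm hg.1 hf.1
    _ ≤ _ := by
        gcongr
        exact eLpNorm_le_eLpNorm_of_exponent_le hle hg.1

lemma p2_le_p4 {p₁ p₂ p₄ : ℝ} (hp₂ : 1 ≤ p₂) (hp₁ : p₂ < p₁)
    (hp₄ : p₁ * p₂ / (p₁ - p₂) ≤ p₄) : p₂ ≤ p₄ := by
  have hd : 0 < p₁ - p₂ := by linarith
  refine le_trans ?_ hp₄
  rw [le_div_iff₀ hd]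
  nlinarith

lemma core_est {f g : α → ℝ} {p₁ p₂ p₄ : ℝ} (hp₂ : 1 ≤ p₂) (hp₁ : p₂ < p₁)
    (hp₄ : p₁ * p₂ / (p₁ - p₂) ≤ p₄)
    (hf : MemLp f (ENNReal.ofReal p₁) μ) (hg : MemLp g (ENNReal.ofReal p₄) μ) (c d : ℝ) :
    eLpNorm (fun x => f x * g x - c * d) (ENNReal.ofReal p₂) μ ≤
      eLpNorm (fun x => f x - c) (ENNReal.ofReal p₁) μ * eLpNorm g (ENNReal.ofReal p₄) μ +
        ‖c‖ₑ * eLpNorm (fun x => g x - d) (ENNReal.ofReal p₂) μ := by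
  have h1 : (1 : ℝ≥0∞) ≤ ENNReal.ofReal p₂ := by simpa using hp₂
  have hfc : MemLp (fun x => f x - c) (ENNReal.ofReal p₁) μ := hf.sub (memLp_const c)
  have hg2 : MemLp g (ENNReal.ofReal p₂) μ :=
    hg.mono_exponent (ENNReal.ofReal_le_ofReal (p2_le_p4 hp₂ hp₁ hp₄))
  have hgd : MemLp (fun x => g x - d) (ENNReal.ofReal p₂) μ := hg2.sub (memLp_const d)
  obtain ⟨ha, hb⟩ := core_holder hp₂ hp₁ hp₄ hfc hg
  have he : (fun x => f x * g x - c * d) =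
      (fun x => (f x - c) * g x) + c • (fun x => g x - d) := by
    funext x; simp; ring
  rw [he]
  refine (eLpNorm_add_le ha.1 (hgd.1.const_smul c) h1).trans ?_
  rw [eLpNorm_const_smul]
  gcongr

lemma memLp_eq {h : α → ℝ} {p : ℝ} (hp : 1 ≤ p) (hh : MemLp h (ENNReal.ofReal p) μ) :
    ENNReal.ofReal ((∫ x, |h x| ^ p ∂μ) ^ (1 / p)) = eLpNorm h (ENNReal.ofReal p) μ := by
  have hp0 : 0 < p := by linarith
  rw [hh.eLpNorm_eq_integral_rpow_norm (by simpa using hp0) (by simp),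
    ENNReal.toReal_ofReal hp0.le, one_div]
  rfl

end generic

section balls

variable {n : ℕ}

def nu (x : EuclideanSpace ℝ (Fin n)) (r : ℝ) : Measure (EuclideanSpace ℝ (Fin n)) :=
  (volume (ball x r))⁻¹ • volume.restrict (ball x r)

lemma vol_pos (x : EuclideanSpace ℝ (Fin n)) {r : ℝ} (hr : 0 < r) : volume (ball x r) ≠ 0 :=
  (measure_ball_pos volume x hr).ne'

lemma nu_prob (x : EuclideanSpace ℝ (Fin n)) {r : ℝ} (hr : 0 < r) :
    IsProbabilityMeasure (nu x r) := by
  constructor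
  simp only [nu, Measure.smul_apply, Measure.restrict_apply MeasurableSet.univ, Set.univ_inter,
    smul_eq_mul]
  exact ENNReal.inv_mul_cancel (vol_pos x hr) measure_ball_lt_top.ne

lemma nu_int (h : EuclideanSpace ℝ (Fin n) → ℝ) (x : EuclideanSpace ℝ (Fin n)) (r : ℝ) :
    (volume (ball x r)).toReal⁻¹ * ∫ y in ball x r, h y = ∫ y, h y ∂nu x r := by
  rw [nu, integral_smul_measure, ENNReal.toReal_inv, smul_eq_mul]

lemma nu_memLp {p : ℝ} (hp : 1 ≤ p) {h : EuclideanSpace ℝ (Fin n) → ℝ} (hh : MemLpLoc p h)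
    (x : EuclideanSpace ℝ (Fin n)) {r : ℝ} (hr : 0 < r) :
    MemLp h (ENNReal.ofReal p) (nu x r) := by
  have hp0 : 0 < p := by linarith
  refine MemLp.smul_measure ?_ (ENNReal.inv_ne_top.2 (vol_pos x hr))
  rw [← integrable_norm_rpow_iff hh.1.aestronglyMeasurable.restrict (by simpa using hp0) (by simp),
    ENNReal.toReal_ofReal hp0.le]
  exact hh.2 x r hr

/-- The oscillation is controlled by the Campanato seminorm. -/
lemma camp_le {p : ℝ} (hp : 1 ≤ p) {φ : EuclideanSpace ℝ (Fin n) → ℝ → ℝ}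
    {h : EuclideanSpace ℝ (Fin n) → ℝ} (hh : MemLpLoc p h)
    (x : EuclideanSpace ℝ (Fin n)) {r : ℝ} (hr : 0 < r) (hφ : 0 < φ x r) :
    eLpNorm (fun y => h y - ballAvg h x r) (ENNReal.ofReal p) (nu x r) ≤
      ENNReal.ofReal (φ x r) * campSemi p φ h := by
  have := nu_prob x hr
  have hm : MemLp (fun y => h y - ballAvg h x r) (ENNReal.ofReal p) (nu x r) :=
    (nu_memLp hp hh x hr).sub (memLp_const _)
  have h1 : ENNReal.ofReal ((φ x r)⁻¹ *
      ((volume (ball x r)).toReal⁻¹ * ∫ y in ball x r, |h y - ballAvg h x r| ^ p) ^ (1 / p))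
      ≤ campSemi p φ h :=
    le_iSup_of_le x (le_iSup_of_le r (le_iSup_of_le hr le_rfl))
  rw [nu_int (fun y => |h y - ballAvg h x r| ^ p), ENNReal.ofReal_mul (by positivity),
    memLp_eq hp hm] at h1
  calc _ = ENNReal.ofReal (φ x r) * (ENNReal.ofReal (φ x r)⁻¹ *
        eLpNorm (fun y => h y - ballAvg h x r) (ENNReal.ofReal p) (nu x r)) := by
        rw [← mul_assoc, ← ENNReal.ofReal_mul hφ.le, mul_inv_cancel₀ hφ.ne']; simp
    _ ≤ _ := by gcongr

lemma morrey_le {p : ℝ} (hp : 1 ≤ p) {φ : EuclideanSpace ℝ (Fin n) → ℝ → ℝ}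
    {h : EuclideanSpace ℝ (Fin n) → ℝ} (hh : MemLpLoc p h)
    (x : EuclideanSpace ℝ (Fin n)) {r : ℝ} (hr : 0 < r) (hφ : 0 < φ x r) :
    eLpNorm h (ENNReal.ofReal p) (nu x r) ≤
      ENNReal.ofReal (φ x r) * morreyNorm p φ h := by
  have := nu_prob x hr
  have hm : MemLp h (ENNReal.ofReal p) (nu x r) := nu_memLp hp hh x hr
  have h1 : ENNReal.ofReal ((φ x r)⁻¹ *
      ((volume (ball x r)).toReal⁻¹ * ∫ y in ball x r, |h y| ^ p) ^ (1 / p))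
      ≤ morreyNorm p φ h :=
    le_iSup_of_le x (le_iSup_of_le r (le_iSup_of_le hr le_rfl))
  rw [nu_int (fun y => |h y| ^ p), ENNReal.ofReal_mul (by positivity),
    memLp_eq hp hm] at h1
  calc _ = ENNReal.ofReal (φ x r) * (ENNReal.ofReal (φ x r)⁻¹ *
        eLpNorm h (ENNReal.ofReal p) (nu x r)) := by
        rw [← mul_assoc, ← ENNReal.ofReal_mul hφ.le, mul_inv_cancel₀ hφ.ne']; simp
    _ ≤ _ := by gcongr

/-- comparison of averages over nested balls -/
lemma avg_step {p : ℝ} (hp : 1 ≤ p) {φ : EuclideanSpace ℝ (Fin n) → ℝ → ℝ}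
    {f : EuclideanSpace ℝ (Fin n) → ℝ} (hf : MemLpLoc p f)
    (x y : EuclideanSpace ℝ (Fin n)) {r s : ℝ} (hr : 0 < r) (hs : 0 < s) (hφ : 0 < φ x r)
    (hsub : ball y s ⊆ ball x r) (hrs : r ≤ 4 * s) :
    ENNReal.ofReal |ballAvg f y s - ballAvg f x r| ≤
      ENNReal.ofReal (4 ^ n * φ x r) * campSemi p φ f := by
  have := nu_prob x hr
  have := nu_prob y hs
  set c := ballAvg f x r with hc
  have h1 : (1 : ℝ≥0∞) ≤ ENNReal.ofReal p := by simpa using hp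
  have hfi : Integrable f (nu y s) := (nu_memLp hp hf y hs).integrable h1
  have e1 : ballAvg f y s - c = ∫ z, (f z - c) ∂nu y s := by
    rw [integral_sub hfi (integrable_const c)]
    simp [ballAvg, nu_int]
  have hvol : volume (ball x r) ≤ 4 ^ n * volume (ball y s) := by
    rw [Measure.addHaar_ball_of_pos volume x hr, Measure.addHaar_ball_of_pos volume y hs,
      ← mul_assoc, finrank_euclideanSpace_fin]
    gcongr
    have : (4 : ℝ≥0∞) ^ n = ENNReal.ofReal (4 ^ n) := by
      rw [ENNReal.ofReal_pow (by norm_num)]; norm_num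
    rw [this, ← ENNReal.ofReal_mul (by positivity), ← mul_pow]
    gcongr
  have hvol2 : (volume (ball y s))⁻¹ ≤ 4 ^ n * (volume (ball x r))⁻¹ := by
    rw [← div_eq_mul_inv, ENNReal.le_div_iff_mul_le (Or.inl (vol_pos x hr))
      (Or.inl measure_ball_lt_top.ne)]
    calc _ ≤ (volume (ball y s))⁻¹ * (4 ^ n * volume (ball y s)) := by gcongr
      _ = 4 ^ n * ((volume (ball y s))⁻¹ * volume (ball y s)) := by ring
      _ = 4 ^ n := by
        rw [ENNReal.inv_mul_cancel (vol_pos y hs) measure_ball_lt_top.ne, mul_one]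
  have hm : MemLp (fun y => f y - c) (ENNReal.ofReal p) (nu x r) :=
    (nu_memLp hp hf x hr).sub (memLp_const _)
  rw [e1, ← Real.norm_eq_abs, ofReal_norm]
  calc ‖∫ z, (f z - c) ∂nu y s‖ₑ ≤ ∫⁻ z, ‖f z - c‖ₑ ∂nu y s := enorm_integral_le_lintegral_enorm _
    _ = (volume (ball y s))⁻¹ * ∫⁻ z in ball y s, ‖f z - c‖ₑ := by
      rw [nu, lintegral_smul_measure, smul_eq_mul]
    _ ≤ (4 ^ n * (volume (ball x r))⁻¹) * ∫⁻ z in ball x r, ‖f z - c‖ₑ := by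
      gcongr
    _ = 4 ^ n * eLpNorm (fun z => f z - c) 1 (nu x r) := by
      rw [eLpNorm_one_eq_lintegral_enorm, nu, lintegral_smul_measure, smul_eq_mul, mul_assoc]
    _ ≤ 4 ^ n * eLpNorm (fun z => f z - c) (ENNReal.ofReal p) (nu x r) := by
      gcongr
      exact eLpNorm_le_eLpNorm_of_exponent_le h1 hm.1
    _ ≤ 4 ^ n * (ENNReal.ofReal (φ x r) * campSemi p φ f) := by
      gcongr
      exact camp_le hp hf x hr hφ
    _ = _ := by
      rw [ENNReal.ofReal_mul (by positivity), ENNReal.ofReal_pow (by norm_num), mul_assoc]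
      norm_num

lemma doub_le {A : ℝ} {φ : EuclideanSpace ℝ (Fin n) → ℝ → ℝ}
    (hpos : GrowthPos φ) (hD : DoublingWith A φ) (x : EuclideanSpace ℝ (Fin n)) {s t : ℝ}
    (hs : 0 < s) (ht : 0 < t) (h1 : s ≤ 2 * t) (h2 : t ≤ 2 * s) : φ x s ≤ A * φ x t := by
  have := (hD x t s ht hs (by rw [le_div_iff₀ ht]; linarith) (by rw [div_le_iff₀ ht]; exact h1)).2
  rwa [div_le_iff₀ (hpos x t ht)] at this

lemma phi_ii {A : ℝ} {φ : EuclideanSpace ℝ (Fin n) → ℝ → ℝ}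
    (hpos : GrowthPos φ) (hD : DoublingWith A φ)
    (hm : ∀ x : EuclideanSpace ℝ (Fin n), Measurable fun t => φ x t)
    (x : EuclideanSpace ℝ (Fin n)) {a b : ℝ} (ha : 0 < a) (hab : a ≤ b) :
    IntervalIntegrable (fun t => φ x t / t) volume a b := by
  have step : ∀ a : ℝ, 0 < a → IntervalIntegrable (fun t => φ x t / t) volume a (2 * a) := by
    intro a ha
    rw [intervalIntegrable_iff_integrableOn_Icc_of_le (by linarith)]
    refine Measure.integrableOn_of_bounded (M := A * φ x a / a) (by simp)
      ((hm x).div measurable_id).aestronglyMeasurable ?_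
    refine (ae_restrict_iff' measurableSet_Icc).2 (Eventually.of_forall fun t ht => ?_)
    have ht0 : 0 < t := ha.trans_le ht.1
    have h1 := doub_le hpos hD x ht0 ha ht.2 (by linarith [ht.1])
    have h0 := hpos x t ht0
    rw [Real.norm_of_nonneg (by positivity)]
    exact div_le_div₀ (h0.le.trans h1) h1 ha ht.1
  have pw : ∀ k : ℕ, IntervalIntegrable (fun t => φ x t / t) volume a (2 ^ k * a) := by
    intro k
    induction k with
    | zero => simp
    | succ k ih =>
      have := ih.trans (step (2 ^ k * a) (by positivity))
      rwa [← mul_assoc, ← pow_succ'] at this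
  obtain ⟨k, hk⟩ := pow_unbounded_of_one_lt (b / a) (one_lt_two)
  rw [div_lt_iff₀ ha] at hk
  refine (pw k).mono_set ?_
  rw [Set.uIcc_of_le hab, Set.uIcc_of_le (hab.trans hk.le)]
  exact Set.Icc_subset_Icc le_rfl hk.le

lemma phi_low {A : ℝ} {φ : EuclideanSpace ℝ (Fin n) → ℝ → ℝ}
    (hpos : GrowthPos φ) (hA : 0 < A) (hD : DoublingWith A φ)
    (hm : ∀ x : EuclideanSpace ℝ (Fin n), Measurable fun t => φ x t)
    (x : EuclideanSpace ℝ (Fin n)) {a : ℝ} (ha : 0 < a) :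
    φ x (2 * a) ≤ 2 * A * ∫ t in a..(2 * a), φ x t / t := by
  have hp := hpos x (2 * a) (by positivity)
  have h : ∫ t in a..(2 * a), φ x (2 * a) / A / (2 * a) ≤ ∫ t in a..(2 * a), φ x t / t := by
    refine intervalIntegral.integral_mono_on (by linarith) (by simp)
      (phi_ii hpos hD hm x ha (by linarith)) fun t ht => ?_
    have ht0 : 0 < t := ha.trans_le ht.1
    have h1 := doub_le hpos hD x (s := 2 * a) (t := t) (by positivity) ht0
      (by linarith [ht.1]) (by linarith [ht.2])
    refine div_le_div₀ (hpos x t ht0).le ?_ ht0 ht.2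
    rw [div_le_iff₀ hA]; linarith
  rw [intervalIntegral.integral_const, smul_eq_mul] at h
  have e : (2 * a - a) * (φ x (2 * a) / A / (2 * a)) = φ x (2 * a) / (2 * A) := by
    field_simp; ring
  rw [e, div_le_iff₀ (by positivity)] at h
  linarith

lemma phi_mono {A : ℝ} {φ : EuclideanSpace ℝ (Fin n) → ℝ → ℝ}
    (hpos : GrowthPos φ) (hD : DoublingWith A φ)
    (hm : ∀ x : EuclideanSpace ℝ (Fin n), Measurable fun t => φ x t)
    (x : EuclideanSpace ℝ (Fin n)) {a b c d : ℝ} (hc : 0 < c) (hca : c ≤ a) (hab : a ≤ b)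
    (hbd : b ≤ d) : ∫ t in a..b, φ x t / t ≤ ∫ t in c..d, φ x t / t := by
  refine intervalIntegral.integral_mono_interval hca hab hbd ?_
    (phi_ii hpos hD hm x hc (by linarith))
  refine (ae_restrict_iff' measurableSet_Ioc).2 (Eventually.of_forall fun t ht => ?_)
  have ht0 : 0 < t := hc.trans ht.1
  have := hpos x t ht0
  simp only [Pi.zero_apply]
  positivity

lemma avg_step' {p : ℝ} (hp : 1 ≤ p) {φ : EuclideanSpace ℝ (Fin n) → ℝ → ℝ}
    {f : EuclideanSpace ℝ (Fin n) → ℝ} (hf : MemLpLoc p f) (hfin : campSemi p φ f ≠ ⊤)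
    (x y : EuclideanSpace ℝ (Fin n)) {r s : ℝ} (hr : 0 < r) (hs : 0 < s) (hφ : 0 < φ x r)
    (hsub : ball y s ⊆ ball x r) (hrs : r ≤ 4 * s) :
    |ballAvg f y s - ballAvg f x r| ≤ 4 ^ n * φ x r * (campSemi p φ f).toReal := by
  have h := avg_step hp hf x y hr hs hφ hsub hrs
  have h2 := ENNReal.toReal_mono (ENNReal.mul_ne_top ENNReal.ofReal_ne_top hfin) h
  rwa [ENNReal.toReal_ofReal (abs_nonneg _), ENNReal.toReal_mul,
    ENNReal.toReal_ofReal (by positivity)] at h2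

lemma avg_chain {A p : ℝ} (hp : 1 ≤ p) {φ : EuclideanSpace ℝ (Fin n) → ℝ → ℝ}
    (hpos : GrowthPos φ) (hA : 0 < A) (hD : DoublingWith A φ)
    (hm : ∀ x : EuclideanSpace ℝ (Fin n), Measurable fun t => φ x t)
    {f : EuclideanSpace ℝ (Fin n) → ℝ} (hf : MemLpLoc p f) (hfin : campSemi p φ f ≠ ⊤)
    (x : EuclideanSpace ℝ (Fin n)) {a : ℝ} (ha : 0 < a) (k : ℕ) :
    |ballAvg f x a - ballAvg f x (2 ^ k * a)| ≤
      4 ^ n * (2 * A) * (campSemi p φ f).toReal * ∫ t in a..(2 ^ k * a), φ x t / t := by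
  induction k with
  | zero => simp
  | succ k ih =>
    set b := 2 ^ k * a with hb
    have hb0 : 0 < b := by positivity
    have hab : a ≤ b := by
      have : (1 : ℝ) ≤ 2 ^ k := one_le_pow₀ (by norm_num)
      nlinarith
    have e : (2 : ℝ) ^ (k + 1) * a = 2 * b := by rw [hb, pow_succ]; ring
    rw [e, ← intervalIntegral.integral_add_adjacent_intervals (phi_ii hpos hD hm x ha hab)
      (phi_ii hpos hD hm x hb0 (by linarith : b ≤ 2 * b))]
    have h1 := avg_step' hp hf hfin x x (r := 2 * b) (s := b) (by positivity) hb0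
      (hpos x _ (by positivity)) (ball_subset_ball (by linarith)) (by linarith)
    have h2 := phi_low hpos hA hD hm x hb0
    have hS : 0 ≤ (campSemi p φ f).toReal := ENNReal.toReal_nonneg
    have h3 : 4 ^ n * φ x (2 * b) * (campSemi p φ f).toReal ≤
        4 ^ n * (2 * A * ∫ t in b..(2 * b), φ x t / t) * (campSemi p φ f).toReal := by gcongr
    have h4 := abs_sub_le (ballAvg f x a) (ballAvg f x b) (ballAvg f x (2 * b))
    linarith

lemma exists_dyadic {r R : ℝ} (hr : 0 < r) (hR : r ≤ R) :
    ∃ k : ℕ, 2 ^ k * r ≤ R ∧ R < 2 * (2 ^ k * r) := by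
  obtain ⟨k, h1, h2⟩ := exists_nat_pow_near (x := R / r) (y := 2)
    (by rwa [le_div_iff₀ hr, one_mul]) one_lt_two
  rw [le_div_iff₀ hr] at h1
  rw [div_lt_iff₀ hr, pow_succ] at h2
  exact ⟨k, h1, by linarith⟩

lemma star_lb {A : ℝ} {φ : EuclideanSpace ℝ (Fin n) → ℝ → ℝ}
    (hpos : GrowthPos φ) (hD : DoublingWith A φ)
    (hm : ∀ x : EuclideanSpace ℝ (Fin n), Measurable fun t => φ x t)
    (x : EuclideanSpace ℝ (Fin n)) (r : ℝ) :
    ∫ t in (1 : ℝ)..2, φ 0 t / t ≤ PhiStar φ x r :=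
  phi_mono hpos hD hm 0 one_pos le_rfl one_le_two (le_max_left _ _)

lemma one_two_pos {A : ℝ} {φ : EuclideanSpace ℝ (Fin n) → ℝ → ℝ}
    (hpos : GrowthPos φ) (hA : 0 < A) (hD : DoublingWith A φ)
    (hm : ∀ x : EuclideanSpace ℝ (Fin n), Measurable fun t => φ x t) :
    0 < ∫ t in (1 : ℝ)..2, φ 0 t / t := by
  have h := phi_low hpos hA hD hm 0 one_pos
  rw [mul_one] at h
  have := hpos 0 2 two_pos
  by_contra hc
  nlinarith

lemma starstar_nonneg {A : ℝ} {φ : EuclideanSpace ℝ (Fin n) → ℝ → ℝ}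
    (hpos : GrowthPos φ) (hD : DoublingWith A φ)
    (hm : ∀ x : EuclideanSpace ℝ (Fin n), Measurable fun t => φ x t)
    (x : EuclideanSpace ℝ (Fin n)) {r : ℝ} (hr : 0 < r) : 0 ≤ PhiStarStar φ x r := by
  have := phi_mono hpos hD hm x (a := r) (b := r) hr le_rfl le_rfl
    ((le_max_right ‖x‖ r).trans (le_max_right 2 _))
  simpa [PhiStarStar] using this

lemma avg_bound {A p : ℝ} (hp : 1 ≤ p) {φ : EuclideanSpace ℝ (Fin n) → ℝ → ℝ}
    (hpos : GrowthPos φ) (hA : 0 < A) (hD : DoublingWith A φ)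
    (hm : ∀ x : EuclideanSpace ℝ (Fin n), Measurable fun t => φ x t) :
    ∃ K > 0, ∀ f : EuclideanSpace ℝ (Fin n) → ℝ, MemLpLoc p f → campSemi p φ f ≠ ⊤ →
      ∀ (x : EuclideanSpace ℝ (Fin n)) (r : ℝ), 0 < r →
      |ballAvg f x r| ≤ K * (PhiStar φ x r + PhiStarStar φ x r) *
        ((campSemi p φ f).toReal + |ballAvg f 0 1|) := by
  set c₀ := ∫ t in (1 : ℝ)..2, φ 0 t / t with hc₀
  have hc₀p : 0 < c₀ := one_two_pos hpos hA hD hm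
  refine ⟨4 ^ n * (2 * A) + 2 * (4 ^ n * (A * (2 * A))) + 1 / c₀, by positivity, ?_⟩
  intro f hf hfin x r hr
  set S := (campSemi p φ f).toReal with hSdef
  have hS : 0 ≤ S := ENNReal.toReal_nonneg
  set R := max 2 (max ‖x‖ r) with hR
  have hR2 : 2 ≤ R := le_max_left _ _
  have hRx : ‖x‖ ≤ R := (le_max_left ‖x‖ r).trans (le_max_right 2 _)
  have hRr : r ≤ R := (le_max_right ‖x‖ r).trans (le_max_right 2 _)
  set P := PhiStar φ x r with hP
  set Q := PhiStarStar φ x r with hQ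
  have hQ0 : 0 ≤ Q := starstar_nonneg hpos hD hm x hr
  have hPc : c₀ ≤ P := star_lb hpos hD hm x r
  have hP0 : 0 < P := hc₀p.trans_le hPc
  have hφR : φ 0 (2 * R) ≤ A * (2 * A) * P := by
    have h1 : φ 0 (2 * R) ≤ A * φ 0 R :=
      doub_le hpos hD 0 (by linarith) (by linarith) le_rfl (by linarith)
    have h2 := phi_low hpos hA hD hm 0 (a := R / 2) (by linarith)
    have e : 2 * (R / 2) = R := by ring
    rw [e] at h2
    have h3 : ∫ t in (R / 2)..R, φ 0 t / t ≤ P :=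
      phi_mono hpos hD hm 0 one_pos (by linarith) (by linarith) le_rfl
    calc _ ≤ A * φ 0 R := h1
      _ ≤ A * (2 * A * P) := by gcongr; exact h2.trans (by gcongr)
      _ = _ := by ring
  have key : ∀ (z : EuclideanSpace ℝ (Fin n)) (s : ℝ), 0 < s → s ≤ R → ‖z‖ ≤ R →
      |ballAvg f z s - ballAvg f 0 (2 * R)| ≤
        4 ^ n * (2 * A) * S * (∫ t in s..R, φ z t / t) + 4 ^ n * (A * (2 * A) * P) * S := by
    intro z s hs hsR hzR
    obtain ⟨k, hk1, hk2⟩ := exists_dyadic hs hsR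
    have hk : s ≤ 2 ^ k * s := by
      have : (1 : ℝ) ≤ 2 ^ k := one_le_pow₀ (by norm_num)
      nlinarith
    have h1 := avg_chain hp hpos hA hD hm hf hfin z hs k
    have h2 := phi_mono hpos hD hm z hs le_rfl hk hk1
    have h3 := avg_step' hp hf hfin 0 z (r := 2 * R) (s := 2 ^ k * s) (by linarith)
      (by positivity) (hpos 0 _ (by linarith))
      (ball_subset_ball' (by rw [dist_zero_right]; linarith)) (by linarith)
    have h4 := abs_sub_le (ballAvg f z s) (ballAvg f z (2 ^ k * s)) (ballAvg f 0 (2 * R))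
    have h5 : 4 ^ n * (2 * A) * S * (∫ t in s..(2 ^ k * s), φ z t / t) ≤
      4 ^ n * (2 * A) * S * (∫ t in s..R, φ z t / t) := by gcongr
    have h6 : 4 ^ n * φ 0 (2 * R) * S ≤ 4 ^ n * (A * (2 * A) * P) * S := by gcongr
    linarith
  have k1 : |ballAvg f x r - ballAvg f 0 (2 * R)| ≤
      4 ^ n * (2 * A) * S * Q + 4 ^ n * (A * (2 * A) * P) * S := key x r hr hRr hRx
  have k2 : |ballAvg f 0 1 - ballAvg f 0 (2 * R)| ≤
      4 ^ n * (2 * A) * S * P + 4 ^ n * (A * (2 * A) * P) * S :=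
    key 0 1 one_pos (by linarith) (by simp; linarith)
  set a₀ := ballAvg f 0 1
  have k3 : |a₀| ≤ 1 / c₀ * P * |a₀| := by
    have : 1 ≤ 1 / c₀ * P := by rw [one_div, inv_mul_eq_div, le_div_iff₀ hc₀p]; linarith
    nlinarith [abs_nonneg a₀]
  have k4 : |ballAvg f x r| ≤ |ballAvg f x r - ballAvg f 0 (2 * R)| +
      |a₀ - ballAvg f 0 (2 * R)| + |a₀| := by
    have e : ballAvg f x r = (ballAvg f x r - ballAvg f 0 (2 * R)) -
      (a₀ - ballAvg f 0 (2 * R)) + a₀ := by ring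
    calc |ballAvg f x r| = |(ballAvg f x r - ballAvg f 0 (2 * R)) -
      (a₀ - ballAvg f 0 (2 * R)) + a₀| := by rw [← e]
      _ ≤ _ := (abs_add_le _ _).trans (by gcongr; exact abs_sub _ _)
  set X : ℝ := 4 ^ n * (2 * A)
  set Y : ℝ := 4 ^ n * (A * (2 * A))
  have hX : 0 ≤ X := by positivity
  have hY : 0 ≤ Y := by positivity
  have hZ : 0 ≤ 1 / c₀ := by positivity
  have ha := abs_nonneg a₀
  have : (X + 2 * Y + 1 / c₀) * (P + Q) * (S + |a₀|) =
      (X * S * Q + 4 ^ n * (A * (2 * A) * P) * S) + (X * S * P + 4 ^ n * (A * (2 * A) * P) * S)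
      + 1 / c₀ * P * |a₀| + (2 * Y * Q * S + X * (P + Q) * |a₀| + 2 * Y * (P + Q) * |a₀|
        + 1 / c₀ * (P + Q) * S + 1 / c₀ * Q * |a₀|) := by
    simp only [X, Y]; ring
  have hrest : 0 ≤ 2 * Y * Q * S + X * (P + Q) * |a₀| + 2 * Y * (P + Q) * |a₀|
        + 1 / c₀ * (P + Q) * S + 1 / c₀ * Q * |a₀| := by positivity
  rw [this]
  linarith

lemma semi_le {p : ℝ} (hp : 1 ≤ p) {φ : EuclideanSpace ℝ (Fin n) → ℝ → ℝ} (hpos : GrowthPos φ)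
    {h : EuclideanSpace ℝ (Fin n) → ℝ} {T : ℝ≥0∞}
    (hh : ∀ (x : EuclideanSpace ℝ (Fin n)) (r : ℝ), 0 < r →
      MemLp h (ENNReal.ofReal p) (nu x r) ∧
      eLpNorm (fun y => h y - ballAvg h x r) (ENNReal.ofReal p) (nu x r) ≤
        ENNReal.ofReal (φ x r) * T) : campSemi p φ h ≤ T := by
  refine iSup_le fun x => iSup_le fun r => iSup_le fun hr => ?_
  have := nu_prob x hr
  obtain ⟨h1, h2⟩ := hh x r hr
  have hφ := hpos x r hr
  have hm : MemLp (fun y => h y - ballAvg h x r) (ENNReal.ofReal p) (nu x r) :=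
    h1.sub (memLp_const _)
  rw [nu_int (fun y => |h y - ballAvg h x r| ^ p), ENNReal.ofReal_mul (by positivity),
    memLp_eq hp hm]
  calc _ ≤ ENNReal.ofReal (φ x r)⁻¹ * (ENNReal.ofReal (φ x r) * T) := by gcongr
    _ = T := by rw [← mul_assoc, ← ENNReal.ofReal_mul (by positivity), inv_mul_cancel₀ hφ.ne']; simp

end balls

/-- With `φ₃ = φ₂/(Φ₁* + Φ₁**)`, every
`g ∈ 𝓛𝓝_{p₂,φ₃} ∩ L_{p₄,φ₂/φ₁}` is a pointwise multiplier from `𝓛𝓝_{p₁,φ₁}` to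
`𝓛𝓝_{p₂,φ₂}`, with operator norm controlled by `‖g‖_{𝓛_{p₂,φ₃}} + ‖g‖_{L_{p₄,φ₂/φ₁}}`. -/
theorem pointwise_multiplier_campanato (n : ℕ) (p₁ p₂ p₄ : ℝ)
    (hp₂ : 1 ≤ p₂) (hp₁ : p₂ < p₁) (hp₄ : p₁ * p₂ / (p₁ - p₂) ≤ p₄)
    (φ₁ φ₂ : EuclideanSpace ℝ (Fin n) → ℝ → ℝ)
    (hφ₁pos : GrowthPos φ₁) (hφ₂pos : GrowthPos φ₂)
    (hD₁ : Doubling φ₁) (hD₂ : Doubling φ₂)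
    (hm : ∀ x : EuclideanSpace ℝ (Fin n), Measurable fun t => φ₁ x t) :
    ∃ C > 0, ∀ g : EuclideanSpace ℝ (Fin n) → ℝ, MemLpLoc p₂ g → MemLpLoc p₄ g →
      campNorm p₂ (fun x r => φ₂ x r / (PhiStar φ₁ x r + PhiStarStar φ₁ x r)) g < ⊤ →
      morreyNorm p₄ (fun x r => φ₂ x r / φ₁ x r) g < ⊤ →
      ∀ f : EuclideanSpace ℝ (Fin n) → ℝ, MemLpLoc p₁ f → campNorm p₁ φ₁ f < ⊤ →
        campNorm p₂ φ₂ (fun x => f x * g x) < ⊤ ∧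
        campNorm p₂ φ₂ (fun x => f x * g x) ≤
          ENNReal.ofReal C *
            ((campSemi p₂ (fun x r => φ₂ x r / (PhiStar φ₁ x r + PhiStarStar φ₁ x r)) g +
              morreyNorm p₄ (fun x r => φ₂ x r / φ₁ x r) g) * campNorm p₁ φ₁ f) := by
  obtain ⟨A, hA, hD⟩ := hD₁
  have hp1 : 1 ≤ p₁ := by linarith
  have hp4 : 1 ≤ p₄ := hp₂.trans (p2_le_p4 hp₂ hp₁ hp₄)
  have hp2E : (1 : ℝ≥0∞) ≤ ENNReal.ofReal p₂ := by simpa using hp₂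
  obtain ⟨K, hK, hKf⟩ := avg_bound hp1 hφ₁pos hA hD hm
  have h1p := hφ₁pos 0 1 one_pos
  have h2p := hφ₂pos 0 1 one_pos
  refine ⟨2 * (1 + K) + (φ₂ 0 1 + φ₂ 0 1 / φ₁ 0 1), by positivity, ?_⟩
  intro g hg2 hg4 hgN hgM f hf hfN
  set φ₃ : EuclideanSpace ℝ (Fin n) → ℝ → ℝ :=
    fun x r => φ₂ x r / (PhiStar φ₁ x r + PhiStarStar φ₁ x r) with hφ₃
  set G := campSemi p₂ φ₃ g with hG
  set M := morreyNorm p₄ (fun x r => φ₂ x r / φ₁ x r) g with hM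
  set F := campNorm p₁ φ₁ f with hF
  have hGtop : G < ⊤ := lt_of_le_of_lt le_self_add hgN
  have hSF : campSemi p₁ φ₁ f ≤ F := le_self_add
  have hSfin : campSemi p₁ φ₁ f ≠ ⊤ := (hSF.trans_lt hfN).ne
  have hmem : ∀ (x : EuclideanSpace ℝ (Fin n)) (r : ℝ), 0 < r →
      MemLp (fun y => f y * g y) (ENNReal.ofReal p₂) (nu x r) := by
    intro x r hr
    have := nu_prob x hr
    exact (core_holder hp₂ hp₁ hp₄ (nu_memLp hp1 hf x hr) (nu_memLp hp4 hg4 x hr)).1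
  have hfirst : ∀ (x : EuclideanSpace ℝ (Fin n)) (r : ℝ), 0 < r →
      eLpNorm (fun y => f y - ballAvg f x r) (ENNReal.ofReal p₁) (nu x r) *
        eLpNorm g (ENNReal.ofReal p₄) (nu x r) ≤ ENNReal.ofReal (φ₂ x r) * (M * F) := by
    intro x r hr
    have a1 := hφ₁pos x r hr
    have a2 := hφ₂pos x r hr
    calc _ ≤ (ENNReal.ofReal (φ₁ x r) * campSemi p₁ φ₁ f) *
          (ENNReal.ofReal (φ₂ x r / φ₁ x r) * M) := by
          gcongr
          · exact camp_le hp1 hf x hr a1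
          · exact morrey_le (φ := fun x r => φ₂ x r / φ₁ x r) hp4 hg4 x hr (by positivity)
      _ ≤ (ENNReal.ofReal (φ₁ x r) * F) * (ENNReal.ofReal (φ₂ x r / φ₁ x r) * M) := by gcongr
      _ = (ENNReal.ofReal (φ₁ x r) * ENNReal.ofReal (φ₂ x r / φ₁ x r)) * (M * F) := by ring
      _ = _ := by rw [← ENNReal.ofReal_mul a1.le, mul_div_cancel₀ _ a1.ne']
  have hsemi : campSemi p₂ φ₂ (fun x => f x * g x) ≤
      ENNReal.ofReal (2 * (1 + K)) * ((G + M) * F) := by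
    refine semi_le hp₂ hφ₂pos fun x r hr => ⟨hmem x r hr, ?_⟩
    have := nu_prob x hr
    have a1 := hφ₁pos x r hr
    have a2 := hφ₂pos x r hr
    have hΨ : 0 < PhiStar φ₁ x r + PhiStarStar φ₁ x r :=
      add_pos_of_pos_of_nonneg
        ((one_two_pos hφ₁pos hA hD hm).trans_le (star_lb hφ₁pos hD hm x r))
        (starstar_nonneg hφ₁pos hD hm x hr)
    set Ψ := PhiStar φ₁ x r + PhiStarStar φ₁ x r with hΨd
    have hc : ‖ballAvg f x r‖ₑ ≤ ENNReal.ofReal (K * Ψ) * F := by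
      rw [← ofReal_norm, Real.norm_eq_abs]
      calc _ ≤ ENNReal.ofReal (K * Ψ * ((campSemi p₁ φ₁ f).toReal + |ballAvg f 0 1|)) :=
            ENNReal.ofReal_le_ofReal (hKf f hf hSfin x r hr)
        _ = _ := by
          rw [ENNReal.ofReal_mul (by positivity), ENNReal.ofReal_add ENNReal.toReal_nonneg
            (abs_nonneg _), ENNReal.ofReal_toReal hSfin]
          rfl
    have hg' : eLpNorm (fun y => g y - ballAvg g x r) (ENNReal.ofReal p₂) (nu x r) ≤
        ENNReal.ofReal (φ₂ x r / Ψ) * G :=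
      camp_le (φ := φ₃) hp₂ hg2 x hr (by simp only [hφ₃]; positivity)
    have hsecond : ‖ballAvg f x r‖ₑ *
        eLpNorm (fun y => g y - ballAvg g x r) (ENNReal.ofReal p₂) (nu x r) ≤
        ENNReal.ofReal (φ₂ x r) * (ENNReal.ofReal K * (G * F)) := by
      calc _ ≤ (ENNReal.ofReal (K * Ψ) * F) * (ENNReal.ofReal (φ₂ x r / Ψ) * G) := by gcongr
        _ = (ENNReal.ofReal (K * Ψ) * ENNReal.ofReal (φ₂ x r / Ψ)) * (G * F) := by ring
        _ = _ := by
          rw [← ENNReal.ofReal_mul (by positivity), ← mul_assoc (ENNReal.ofReal (φ₂ x r)),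
            ← ENNReal.ofReal_mul a2.le]
          congr 2
          field_simp
    have hosc := eLp_osc_le hp2E (hmem x r hr) (ballAvg f x r * ballAvg g x r)
    rw [← nu_int] at hosc
    refine hosc.trans ?_
    calc _ ≤ 2 * (ENNReal.ofReal (φ₂ x r) * (M * F) +
          ENNReal.ofReal (φ₂ x r) * (ENNReal.ofReal K * (G * F))) := by
          gcongr
          exact (core_est hp₂ hp₁ hp₄ (nu_memLp hp1 hf x hr) (nu_memLp hp4 hg4 x hr) _ _).trans
            (add_le_add (hfirst x r hr) hsecond)
      _ ≤ 2 * (ENNReal.ofReal (φ₂ x r) * (M * F) +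
          ENNReal.ofReal (φ₂ x r) * (ENNReal.ofReal K * (G * F))) +
          2 * (ENNReal.ofReal (φ₂ x r) * (G * F) +
          ENNReal.ofReal (φ₂ x r) * (ENNReal.ofReal K * (M * F))) := le_self_add
      _ = _ := by
          rw [ENNReal.ofReal_mul (by norm_num), ENNReal.ofReal_add (by norm_num) hK.le]
          simp only [ENNReal.ofReal_one, ENNReal.ofReal_ofNat]
          ring
  have havg : ENNReal.ofReal |ballAvg (fun x => f x * g x) 0 1| ≤
      ENNReal.ofReal (φ₂ 0 1 + φ₂ 0 1 / φ₁ 0 1) * ((G + M) * F) := by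
    have := nu_prob (0 : EuclideanSpace ℝ (Fin n)) one_pos
    have e := core_est hp₂ hp₁ hp₄ (nu_memLp hp1 hf 0 one_pos) (nu_memLp hp4 hg4 0 one_pos)
      (ballAvg f 0 1) 0
    simp only [mul_zero, sub_zero] at e
    have e2 : ‖ballAvg f 0 1‖ₑ ≤ F := by
      rw [← ofReal_norm, Real.norm_eq_abs]
      exact le_add_self
    have e3 : eLpNorm g (ENNReal.ofReal p₂) (nu 0 1) ≤ ENNReal.ofReal (φ₂ 0 1 / φ₁ 0 1) * M :=
      (eLpNorm_le_eLpNorm_of_exponent_le (ENNReal.ofReal_le_ofReal (p2_le_p4 hp₂ hp₁ hp₄))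
        (nu_memLp hp4 hg4 0 one_pos).1).trans
        (morrey_le (φ := fun x r => φ₂ x r / φ₁ x r) hp4 hg4 0 one_pos (by positivity))
    rw [← Real.norm_eq_abs, ofReal_norm, ballAvg, nu_int]
    refine (abs_integral_le_eLp hp2E (hmem 0 1 one_pos)).trans (e.trans ?_)
    calc _ ≤ ENNReal.ofReal (φ₂ 0 1) * (M * F) + F * (ENNReal.ofReal (φ₂ 0 1 / φ₁ 0 1) * M) := by
          exact add_le_add (hfirst 0 1 one_pos) (mul_le_mul' e2 e3)
      _ = ENNReal.ofReal (φ₂ 0 1 + φ₂ 0 1 / φ₁ 0 1) * (M * F) := by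
          rw [ENNReal.ofReal_add (by positivity) (by positivity)]; ring
      _ ≤ _ := by gcongr; exact le_add_self
  have hfinal : campNorm p₂ φ₂ (fun x => f x * g x) ≤
      ENNReal.ofReal (2 * (1 + K) + (φ₂ 0 1 + φ₂ 0 1 / φ₁ 0 1)) * ((G + M) * F) := by
    rw [ENNReal.ofReal_add (by positivity) (by positivity), add_mul]
    exact add_le_add hsemi havg
  refine ⟨hfinal.trans_lt ?_, hfinal⟩
  exact ENNReal.mul_lt_top ENNReal.ofReal_lt_top
    (ENNReal.mul_lt_top (ENNReal.add_lt_top.2 ⟨hGtop, hgM⟩) hfN)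

end
end

section
/- Let p ≥ 2, −n/p ≤ α̃ < 0 < α ≤ 1, −n/p ≤ β < 0, and let φ, ψ : ℝⁿ × (0,∞) → (0,∞) be defined by: φ(x,r) = r^α if |x| ≤ 2 and 0 < r ≤ 2, φ(x,r) = r^{α̃} if |x| > 2 and 0 < r ≤ 2, φ(x,r) = r^β if r > 2; and ψ(x,r) = r^α if |x| ≤ 2 and 0 < r ≤ 2, ψ(x,r) = r^{2α̃} if |x| > 2 and 0 < r ≤ 2, ψ(x,r) = r^β if r > 2. Then there is a constant C such that ‖fg‖_{𝓛𝓝_{p/2,ψ}} ≤ C‖f‖_{𝓛𝓝_{p,φ}} ‖g‖_{𝓛𝓝_{p,φ}} for all f, g ∈ 𝓛𝓝_{p,φ}(ℝⁿ). -/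
open MeasureTheory Metric Filter
open scoped ENNReal NNReal

noncomputable section

/-- The specific growth function of Section 6:
`r^a` for `|x| ≤ 2, r ≤ 2`; `r^b` for `|x| > 2, r ≤ 2`; `r^c` for `r > 2`. -/
def phiEx (n : ℕ) (a b c : ℝ) : EuclideanSpace ℝ (Fin n) → ℝ → ℝ :=
  fun x r => if r ≤ 2 then (if ‖x‖ ≤ 2 then r ^ a else r ^ b) else r ^ c

section helpers

variable {Ω : Type*} [MeasurableSpace Ω]

def NN (μ : Measure Ω) (q : ℝ) (h : Ω → ℝ) : ℝ := (∫ y, |h y| ^ q ∂μ) ^ (1 / q)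

lemma NN_eq (μ : Measure Ω) {q : ℝ} (hq : 1 ≤ q) {h : Ω → ℝ} (hh : MemLp h (ENNReal.ofReal q) μ) :
    NN μ q h = (eLpNorm h (ENNReal.ofReal q) μ).toReal := by
  have h0 : 0 < q := by linarith
  have hne : ENNReal.ofReal q ≠ 0 := by simpa using h0
  rw [hh.eLpNorm_eq_integral_rpow_norm hne ENNReal.ofReal_ne_top]
  rw [ENNReal.toReal_ofReal h0.le, ENNReal.toReal_ofReal (by positivity)]
  simp [NN, Real.norm_eq_abs]

lemma NN_nonneg (μ : Measure Ω) (q : ℝ) (h : Ω → ℝ) : 0 ≤ NN μ q h := by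
  unfold NN; positivity

lemma NN_add (μ : Measure Ω) {q : ℝ} (hq : 1 ≤ q) {f g : Ω → ℝ}
    (hf : MemLp f (ENNReal.ofReal q) μ) (hg : MemLp g (ENNReal.ofReal q) μ) :
    NN μ q (fun x => f x + g x) ≤ NN μ q f + NN μ q g := by
  have hfg : MemLp (fun x => f x + g x) (ENNReal.ofReal q) μ := hf.add hg
  rw [NN_eq μ hq hfg, NN_eq μ hq hf, NN_eq μ hq hg,
    ← ENNReal.toReal_add hf.eLpNorm_ne_top hg.eLpNorm_ne_top]
  apply ENNReal.toReal_mono (ENNReal.add_ne_top.2 ⟨hf.eLpNorm_ne_top, hg.eLpNorm_ne_top⟩)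
  exact eLpNorm_add_le hf.1 hg.1 (by simpa using hq)

lemma NN_const (μ : Measure Ω) [IsProbabilityMeasure μ] {q : ℝ} (hq : 1 ≤ q) (c : ℝ) :
    NN μ q (fun _ => c) = |c| := by
  have h0 : q ≠ 0 := by linarith
  simp [NN]
  rw [← Real.rpow_mul (abs_nonneg c), mul_inv_cancel₀ h0, Real.rpow_one]

lemma NN_const_mul (μ : Measure Ω) {q : ℝ} (hq : 1 ≤ q) (c : ℝ) (f : Ω → ℝ) :
    NN μ q (fun x => c * f x) = |c| * NN μ q f := by
  have h0 : q ≠ 0 := by linarith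
  simp only [NN, abs_mul]
  simp_rw [Real.mul_rpow (abs_nonneg _) (abs_nonneg _)]
  rw [integral_const_mul, Real.mul_rpow (by positivity) (by positivity),
    ← Real.rpow_mul (abs_nonneg c), mul_one_div_cancel h0, Real.rpow_one]

lemma NN_mono_exp (μ : Measure Ω) [IsProbabilityMeasure μ] {q p : ℝ} (hq : 1 ≤ q) (hqp : q ≤ p)
    {f : Ω → ℝ} (hf : MemLp f (ENNReal.ofReal p) μ) : NN μ q f ≤ NN μ p f := by
  have hpq := ENNReal.ofReal_le_ofReal hqp
  rw [NN_eq μ hq (hf.mono_exponent hpq), NN_eq μ (hq.trans hqp) hf]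
  exact ENNReal.toReal_mono hf.eLpNorm_ne_top (eLpNorm_le_eLpNorm_of_exponent_le hpq hf.1)

lemma int_le_NN (μ : Measure Ω) [IsProbabilityMeasure μ] {p : ℝ} (hp : 1 ≤ p)
    {f : Ω → ℝ} (hf : MemLp f (ENNReal.ofReal p) μ) : ∫ y, |f y| ∂μ ≤ NN μ p f := by
  have := NN_mono_exp μ le_rfl hp hf
  simpa [NN] using this

lemma abs_int_le_NN (μ : Measure Ω) [IsProbabilityMeasure μ] {p : ℝ} (hp : 1 ≤ p)
    {f : Ω → ℝ} (hf : MemLp f (ENNReal.ofReal p) μ) : |∫ y, f y ∂μ| ≤ NN μ p f :=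
  (abs_integral_le_integral_abs).trans (int_le_NN μ hp hf)

lemma holder_triple {p : ℝ} (hp : 2 ≤ p) :
    ENNReal.HolderTriple (ENNReal.ofReal p) (ENNReal.ofReal p) (ENNReal.ofReal (p / 2)) := by
  constructor
  rw [← ENNReal.ofReal_inv_of_pos (by linarith), ← ENNReal.ofReal_inv_of_pos (by linarith),
    ← ENNReal.ofReal_add (by positivity) (by positivity)]
  congr 1
  field_simp
  norm_num

lemma memLp_mul' (μ : Measure Ω) {p : ℝ} (hp : 2 ≤ p) {f g : Ω → ℝ}
    (hf : MemLp f (ENNReal.ofReal p) μ) (hg : MemLp g (ENNReal.ofReal p) μ) :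
    MemLp (fun x => f x * g x) (ENNReal.ofReal (p / 2)) μ := by
  have := holder_triple hp
  exact hg.mul hf

lemma NN_mul (μ : Measure Ω) {p : ℝ} (hp : 2 ≤ p) {f g : Ω → ℝ}
    (hf : MemLp f (ENNReal.ofReal p) μ) (hg : MemLp g (ENNReal.ofReal p) μ) :
    NN μ (p / 2) (fun x => f x * g x) ≤ NN μ p f * NN μ p g := by
  have := holder_triple hp
  rw [NN_eq μ (by linarith) (memLp_mul' μ hp hf hg), NN_eq μ (by linarith) hf,
    NN_eq μ (by linarith) hg, ← ENNReal.toReal_mul]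
  apply ENNReal.toReal_mono (ENNReal.mul_ne_top hf.eLpNorm_ne_top hg.eLpNorm_ne_top)
  exact eLpNorm_smul_le_mul_eLpNorm (φ := f) (f := g) hg.1 hf.1

/-- key product estimate on a probability space -/
lemma NN_prod (μ : Measure Ω) [IsProbabilityMeasure μ] {p : ℝ} (hp : 2 ≤ p) {f g : Ω → ℝ}
    (hf : MemLp f (ENNReal.ofReal p) μ) (hg : MemLp g (ENNReal.ofReal p) μ) (m m' : ℝ) :
    NN μ (p / 2) (fun x => f x * g x - ∫ y, f y * g y ∂μ) ≤
      2 * (NN μ p (fun x => f x - m) * NN μ p (fun x => g x - m') +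
        |m| * NN μ p (fun x => g x - m') + |m'| * NN μ p (fun x => f x - m)) ∧
    |∫ y, f y * g y ∂μ| ≤ NN μ p (fun x => f x - m) * NN μ p (fun x => g x - m') +
        |m| * NN μ p (fun x => g x - m') + |m'| * NN μ p (fun x => f x - m) + |m| * |m'| := by
  have hq : 1 ≤ p / 2 := by linarith
  have hqp : p / 2 ≤ p := by linarith
  set F : Ω → ℝ := fun x => f x - m with hF
  set G : Ω → ℝ := fun x => g x - m' with hG
  have mF : MemLp F (ENNReal.ofReal p) μ := hf.sub (memLp_const m)
  have mG : MemLp G (ENNReal.ofReal p) μ := hg.sub (memLp_const m')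
  have hexp := ENNReal.ofReal_le_ofReal hqp
  have mF2 := mF.mono_exponent hexp
  have mG2 := mG.mono_exponent hexp
  have mFG := memLp_mul' μ hp mF mG
  have mmG : MemLp (fun x => m * G x) (ENNReal.ofReal (p / 2)) μ := mG2.const_mul m
  have mmF : MemLp (fun x => m' * F x) (ENNReal.ofReal (p / 2)) μ := mF2.const_mul m'
  set w : Ω → ℝ := fun x => (F x * G x + m * G x) + m' * F x with hw
  have mFG1 : MemLp (fun x => F x * G x + m * G x) (ENNReal.ofReal (p / 2)) μ := mFG.add mmG
  have mw : MemLp w (ENNReal.ofReal (p / 2)) μ := mFG1.add mmF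
  have hwb : NN μ (p / 2) w ≤ NN μ p F * NN μ p G + |m| * NN μ p G + |m'| * NN μ p F := by
    have h1 := NN_add μ hq mFG1 mmF
    have h2 := NN_add μ hq mFG mmG
    have h3 := NN_mul μ hp mF mG
    rw [NN_const_mul μ hq] at h1 h2
    have h4 := mul_le_mul_of_nonneg_left (NN_mono_exp μ hq hqp mF) (abs_nonneg m')
    have h5 := mul_le_mul_of_nonneg_left (NN_mono_exp μ hq hqp mG) (abs_nonneg m)
    linarith
  have hfg : ∀ x, f x * g x = w x + m * m' := fun x => by simp only [hw, hF, hG]; ring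
  have iw : Integrable w μ := mw.integrable (by simpa using hq)
  have hint : ∫ y, f y * g y ∂μ = ∫ y, w y ∂μ + m * m' := by
    simp_rw [hfg]
    rw [integral_add iw (integrable_const _)]; simp
  have hiw := abs_int_le_NN μ hq mw
  constructor
  · have : (fun x => f x * g x - ∫ y, f y * g y ∂μ) = fun x => w x + (- ∫ y, w y ∂μ) := by
      funext x; rw [hint, hfg]; ring
    rw [this]
    have h1 := NN_add μ hq mw (memLp_const (- ∫ y, w y ∂μ))
    rw [NN_const μ hq, abs_neg] at h1
    linarith
  · rw [hint]
    have := abs_add_le (∫ y, w y ∂μ) (m * m')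
    rw [abs_mul] at this
    linarith

end helpers

section balls

variable {n : ℕ}

def bmu (x : EuclideanSpace ℝ (Fin n)) (r : ℝ) : Measure (EuclideanSpace ℝ (Fin n)) :=
  (volume (ball x r))⁻¹ • volume.restrict (ball x r)

lemma bmu_prob (x : EuclideanSpace ℝ (Fin n)) {r : ℝ} (hr : 0 < r) :
    IsProbabilityMeasure (bmu x r) := by
  constructor
  simp only [bmu, Measure.smul_apply, Measure.restrict_apply MeasurableSet.univ, Set.univ_inter,
    smul_eq_mul]
  exact ENNReal.inv_mul_cancel (measure_ball_pos _ _ hr).ne' measure_ball_lt_top.ne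

lemma int_bmu (x : EuclideanSpace ℝ (Fin n)) (r : ℝ) (h : EuclideanSpace ℝ (Fin n) → ℝ) :
    ∫ y, h y ∂(bmu x r) = (volume (ball x r)).toReal⁻¹ * ∫ y in ball x r, h y := by
  simp [bmu, integral_smul_measure]

lemma ballAvg_eq (f : EuclideanSpace ℝ (Fin n) → ℝ) (x : EuclideanSpace ℝ (Fin n)) (r : ℝ) :
    ballAvg f x r = ∫ y, f y ∂(bmu x r) := by
  rw [int_bmu]; rfl

lemma campSemi_eq (p : ℝ) (φ : EuclideanSpace ℝ (Fin n) → ℝ → ℝ)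
    (f : EuclideanSpace ℝ (Fin n) → ℝ) : campSemi p φ f =
   ⨆ (x : EuclideanSpace ℝ (Fin n)) (r : ℝ) (_ : 0 < r),
    ENNReal.ofReal ((φ x r)⁻¹ * NN (bmu x r) p (fun y => f y - ballAvg f x r)) := by
  simp only [campSemi, NN, int_bmu]

lemma memLp_bmu {p : ℝ} (hp : 1 ≤ p) {f : EuclideanSpace ℝ (Fin n) → ℝ} (hf : MemLpLoc p f)
    (x : EuclideanSpace ℝ (Fin n)) {r : ℝ} (hr : 0 < r) :
    MemLp f (ENNReal.ofReal p) (bmu x r) := by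
  have h0 : 0 < p := by linarith
  apply MemLp.smul_measure _ (ENNReal.inv_ne_top.2 (measure_ball_pos _ _ hr).ne')
  have hm : AEStronglyMeasurable f (volume.restrict (ball x r)) :=
    hf.1.aestronglyMeasurable.restrict
  rw [← integrable_norm_rpow_iff hm (by simpa using h0) ENNReal.ofReal_ne_top]
  simpa [ENNReal.toReal_ofReal h0.le, Real.norm_eq_abs, IntegrableOn] using hf.2 x r hr

lemma avg_diff {p : ℝ} (hp : 1 ≤ p) {f : EuclideanSpace ℝ (Fin n) → ℝ} (hf : MemLpLoc p f)
    (x y : EuclideanSpace ℝ (Fin n)) {r s : ℝ} (hr : 0 < r) (hs : 0 < s) (hsr : s ≤ 4 * r)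
    (hsub : ball x r ⊆ ball y s) :
    |ballAvg f x r - ballAvg f y s| ≤
      4 ^ n * NN (bmu y s) p (fun z => f z - ballAvg f y s) := by
  have := bmu_prob x hr
  have := bmu_prob y hs
  set c := ballAvg f y s
  have mx : MemLp (fun z => f z - c) (ENNReal.ofReal p) (bmu x r) :=
    (memLp_bmu hp hf x hr).sub (memLp_const c)
  have my : MemLp (fun z => f z - c) (ENNReal.ofReal p) (bmu y s) :=
    (memLp_bmu hp hf y hs).sub (memLp_const c)
  have ifx : Integrable f (bmu x r) := (memLp_bmu hp hf x hr).integrable (by simpa using hp)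
  have e1 : ballAvg f x r - c = ∫ z, (f z - c) ∂(bmu x r) := by
    rw [integral_sub ifx (integrable_const _), ballAvg_eq]; simp
  rw [e1]
  refine abs_integral_le_integral_abs.trans ?_
  refine le_trans ?_ (mul_le_mul_of_nonneg_left (int_le_NN _ hp my) (by positivity))
  rw [int_bmu, int_bmu, ← mul_assoc]
  have hvx : 0 < (volume (ball x r)).toReal :=
    ENNReal.toReal_pos (measure_ball_pos _ _ hr).ne' measure_ball_lt_top.ne
  have hvy : 0 < (volume (ball y s)).toReal :=
    ENNReal.toReal_pos (measure_ball_pos _ _ hs).ne' measure_ball_lt_top.ne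
  have hv : (volume (ball y s)).toReal ≤ 4 ^ n * (volume (ball x r)).toReal := by
    rw [Measure.addHaar_ball_of_pos _ _ hs, Measure.addHaar_ball_of_pos _ _ hr]
    simp only [finrank_euclideanSpace, Fintype.card_fin, ENNReal.toReal_mul]
    rw [ENNReal.toReal_ofReal (by positivity), ENNReal.toReal_ofReal (by positivity), ← mul_assoc,
      ← mul_pow]
    gcongr
  apply mul_le_mul
  · rw [← div_eq_mul_inv, inv_eq_one_div, div_le_div_iff₀ hvx hvy]; linarith
  · apply setIntegral_mono_set
    · have : LocallyIntegrable (fun z => f z - c) volume :=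
        hf.1.sub (locallyIntegrable_const c)
      exact ((this.integrableOn_isCompact (isCompact_closedBall y s)).mono_set
        ball_subset_closedBall).abs
    · exact Filter.Eventually.of_forall fun z => abs_nonneg _
    · exact hsub.eventuallyLE
  · exact integral_nonneg fun z => abs_nonneg _
  · positivity

end balls

section chains

variable {n : ℕ}

lemma chain (u : ℕ → ℝ) {A q : ℝ} (hA : 0 ≤ A) (hq0 : 0 ≤ q) (hq1 : q < 1) (k : ℕ)
    (h : ∀ j < k, |u j - u (j + 1)| ≤ A * q ^ j) : |u 0 - u k| ≤ A / (1 - q) := by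
  have h1 : dist (u 0) (u k) ≤ ∑ i ∈ Finset.range k, A * q ^ i :=
    dist_le_range_sum_of_dist_le k (fun {j} hj => h j hj)
  rw [Real.dist_eq, ← Finset.mul_sum] at h1
  refine h1.trans ?_
  rw [div_eq_mul_inv]
  apply mul_le_mul_of_nonneg_left _ hA
  rw [← tsum_geometric_of_lt_one hq0 hq1]
  exact (summable_geometric_of_lt_one hq0 hq1).sum_le_tsum _ (fun i _ => by positivity)

lemma phi_big {a b c : ℝ} (x : EuclideanSpace ℝ (Fin n)) {r : ℝ} (hr : 2 < r) :
    phiEx n a b c x r = r ^ c := by simp [phiEx, not_le.2 hr]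

lemma phi_in {a b c : ℝ} {x : EuclideanSpace ℝ (Fin n)} {r : ℝ} (hr : r ≤ 2) (hx : ‖x‖ ≤ 2) :
    phiEx n a b c x r = r ^ a := by simp [phiEx, hr, hx]

lemma phi_out {a b c : ℝ} {x : EuclideanSpace ℝ (Fin n)} {r : ℝ} (hr : r ≤ 2) (hx : 2 < ‖x‖) :
    phiEx n a b c x r = r ^ b := by simp [phiEx, hr, not_le.2 hx]

lemma two_pow_rpow (j : ℕ) (e : ℝ) : ((2 : ℝ) ^ j) ^ e = (2 ^ e) ^ j := by
  rw [← Real.rpow_natCast, ← Real.rpow_natCast, ← Real.rpow_mul (by norm_num),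
    ← Real.rpow_mul (by norm_num), mul_comm]

set_option maxHeartbeats 1600000 in
lemma avg_bound_s15 {α αt β D : ℝ} (hαt₁ : αt < 0) (hα₀ : 0 < α) (hβ₁ : β < 0) (hD : 0 ≤ D) :
    ∃ C : ℝ, 0 < C ∧ ∀ (a : EuclideanSpace ℝ (Fin n) → ℝ → ℝ) (K : ℝ), 0 ≤ K →
      |a 0 1| ≤ K →
      (∀ x y r s, 0 < r → 0 < s → s ≤ 4 * r → ball x r ⊆ ball y s →
        |a x r - a y s| ≤ D * (phiEx n α αt β y s * K)) →
      (∀ x r, 2 < r → |a x r| ≤ C * K) ∧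
      (∀ x r, 0 < r → r ≤ 2 → ‖x‖ ≤ 2 → |a x r| ≤ C * K) ∧
      (∀ x r, 0 < r → r ≤ 2 → 2 < ‖x‖ → |a x r| ≤ C * (r ^ αt * K)) := by
  have h2β : (2 : ℝ) ^ β < 1 := Real.rpow_lt_one_of_one_lt_of_neg (by norm_num) hβ₁
  have h2αt : (2 : ℝ) ^ αt < 1 := Real.rpow_lt_one_of_one_lt_of_neg (by norm_num) hαt₁
  have h2α : (2 : ℝ) ^ (-α) < 1 :=
    Real.rpow_lt_one_of_one_lt_of_neg (by norm_num) (by linarith)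
  have p1 : 0 < 1 - (2 : ℝ) ^ β := by linarith
  have p2 : 0 < 1 - (2 : ℝ) ^ αt := by linarith
  have p3 : 0 < 1 - (2 : ℝ) ^ (-α) := by linarith
  set Q := D / (1 - (2 : ℝ) ^ β) with hQ
  set Q2 := D / (1 - (2 : ℝ) ^ αt) with hQ2
  set Q3 := D * 2 ^ α / (1 - (2 : ℝ) ^ (-α)) with hQ3
  have q1 : 0 ≤ Q := by positivity
  have q2 : 0 ≤ Q2 := by positivity
  have q3 : 0 ≤ Q3 := by positivity
  have t1 : (0 : ℝ) < 2 ^ α := by positivity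
  have t2 : (0 : ℝ) < 2 ^ (-αt) := by positivity
  set C1 := 1 + D * 2 ^ α + 2 * Q + D with hC1
  have c1 : 0 < C1 := by positivity
  refine ⟨C1 + (C1 + D + Q3) + ((C1 + D) * 2 ^ (-αt) + Q2), by positivity, ?_⟩
  intro a K hK h0 hstep
  have bound1 : ∀ t : ℝ, 2 < t → t ^ β ≤ 1 := fun t ht =>
    Real.rpow_le_one_of_one_le_of_nonpos (by linarith) hβ₁.le
  have up : ∀ x ρ (k : ℕ), 2 ≤ ρ → |a x ρ - a x (ρ * 2 ^ k)| ≤ Q * K := by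
    intro x ρ k hρ
    have := chain (fun j => a x (ρ * 2 ^ j)) (A := D * K) (q := 2 ^ β) (by positivity)
      (by positivity) h2β k ?_
    · simpa [hQ, div_mul_eq_mul_div] using this
    · intro j _
      have hj : (1 : ℝ) ≤ 2 ^ j := one_le_pow₀ (by norm_num)
      have hbig : 2 < ρ * 2 ^ (j + 1) := by rw [pow_succ]; nlinarith
      have h1 := hstep x x (ρ * 2 ^ j) (ρ * 2 ^ (j + 1)) (by positivity) (by positivity)
        (by rw [pow_succ]; nlinarith) (ball_subset_ball (by rw [pow_succ]; nlinarith))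
      rw [phi_big x hbig] at h1
      refine h1.trans ?_
      have h3 : (ρ * 2 ^ (j + 1)) ^ β ≤ (2 ^ β) ^ j := by
        rw [← two_pow_rpow]
        exact Real.rpow_le_rpow_of_nonpos (by positivity) (by rw [pow_succ]; nlinarith) hβ₁.le
      calc D * ((ρ * 2 ^ (j + 1)) ^ β * K) ≤ D * ((2 ^ β) ^ j * K) := by gcongr
        _ = _ := by ring
  have L1 : ∀ x r, 2 < r → |a x r| ≤ C1 * K := by
    intro x r hr
    obtain ⟨k, hk⟩ := pow_unbounded_of_one_lt ‖x‖ (one_lt_two (α := ℝ))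
    have hk1 : (1 : ℝ) ≤ 2 ^ k := one_le_pow₀ (by norm_num)
    have e1 := up x r k hr.le
    set s := r * 2 ^ k with hs
    have hs2 : 2 ≤ s := by nlinarith
    have hxs : ‖x‖ ≤ s := by nlinarith
    obtain ⟨m, hm1, hm2⟩ := exists_nat_pow_near (x := s) (y := 2) (by linarith) one_lt_two
    have e2 := up 0 2 (m + 1) le_rfl
    have hm0 : (1 : ℝ) ≤ 2 ^ m := one_le_pow₀ (by norm_num)
    have hms : (2 : ℝ) ^ (m + 1) = 2 * 2 ^ m := by ring
    set t := (2 : ℝ) * 2 ^ (m + 1) with ht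
    have ht2 : 2 < t := by linarith
    have e3 := hstep x 0 s t (by linarith) (by linarith) (by linarith)
      (ball_subset_ball' (by rw [dist_zero_right]; linarith))
    rw [phi_big _ ht2] at e3
    have e4 : D * (t ^ β * K) ≤ D * K := by
      have := mul_le_mul_of_nonneg_right (bound1 t ht2) hK
      rw [one_mul] at this
      exact mul_le_mul_of_nonneg_left this hD
    have e5 := hstep 0 0 1 2 (by norm_num) (by norm_num) (by norm_num)
      (ball_subset_ball (by norm_num))
    rw [phi_in le_rfl (by simp)] at e5
    have : C1 * K = K + D * (2 ^ α * K) + 2 * (Q * K) + D * K := by rw [hC1]; ring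
    rw [this]
    rw [abs_le] at *
    constructor <;> linarith [e1.1, e1.2, e2.1, e2.2, e3.1, e3.2, e5.1, e5.2, h0.1, h0.2]
  have L1' : ∀ x s, 1 < s → |a x s| ≤ (C1 + D) * K := by
    intro x s hs
    have e1 := L1 x (2 * s) (by linarith)
    have e3 := hstep x x s (2 * s) (by linarith) (by linarith) (by linarith)
      (ball_subset_ball (by linarith))
    rw [phi_big _ (by linarith)] at e3
    have e4 : D * ((2 * s) ^ β * K) ≤ D * K := by
      have := mul_le_mul_of_nonneg_right (bound1 (2 * s) (by linarith)) hK
      rw [one_mul] at this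
      exact mul_le_mul_of_nonneg_left this hD
    rw [add_mul]
    rw [abs_le] at *
    constructor <;> linarith [e1.1, e1.2, e3.1, e3.2]
  have scale : ∀ r : ℝ, 0 < r → r ≤ 2 → ∃ k : ℕ, 1 < r * 2 ^ k ∧ r * 2 ^ k ≤ 2 := by
    intro r hr hr2
    obtain ⟨m, hm1, hm2⟩ := exists_nat_pow_near (x := 2 / r) (y := 2)
      (by rw [le_div_iff₀ hr]; linarith) one_lt_two
    rw [le_div_iff₀ hr] at hm1
    rw [div_lt_iff₀ hr, pow_succ] at hm2
    exact ⟨m, by linarith, by linarith⟩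
  have L2 : ∀ x r, 0 < r → r ≤ 2 → ‖x‖ ≤ 2 → |a x r| ≤ (C1 + D + Q3) * K := by
    intro x r hr hr2 hx
    obtain ⟨k, hk1, hk2⟩ := scale r hr hr2
    set s := r * 2 ^ k with hs
    have e1 := L1' x s hk1
    have e2 := chain (fun j => a x (s / 2 ^ j)) (A := D * 2 ^ α * K) (q := 2 ^ (-α))
      (by positivity) (by positivity) h2α k ?_
    · have hk : s / 2 ^ k = r := by rw [hs]; field_simp
      have hQK : D * 2 ^ α * K / (1 - 2 ^ (-α)) = Q3 * K := by rw [hQ3]; ring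
      simp only [hk, hQK, pow_zero, div_one] at e2
      rw [add_mul]
      rw [abs_le] at *
      constructor <;> linarith [e1.1, e1.2, e2.1, e2.2]
    · intro j _
      have hj : (1 : ℝ) ≤ 2 ^ j := one_le_pow₀ (by norm_num)
      have hs0 : 0 < s / 2 ^ j := by positivity
      have hs1 : s / 2 ^ (j + 1) = s / 2 ^ j / 2 := by rw [pow_succ]; field_simp
      have hle : s / 2 ^ j ≤ 2 := (div_le_self (by positivity) hj).trans hk2
      have h1 := hstep x x (s / 2 ^ (j + 1)) (s / 2 ^ j) (by positivity) hs0
        (by linarith) (ball_subset_ball (by linarith))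
      rw [phi_in hle hx] at h1
      rw [abs_sub_comm]
      refine h1.trans ?_
      have h3 : (s / 2 ^ j) ^ α ≤ 2 ^ α * (2 ^ (-α)) ^ j := by
        rw [Real.div_rpow (by positivity) (by positivity), two_pow_rpow, div_eq_mul_inv,
          ← inv_pow, ← Real.rpow_neg (by norm_num)]
        gcongr
      calc D * ((s / 2 ^ j) ^ α * K) ≤ D * ((2 ^ α * (2 ^ (-α)) ^ j) * K) := by gcongr
        _ = _ := by ring
  have L3 : ∀ x r, 0 < r → r ≤ 2 → 2 < ‖x‖ →
      |a x r| ≤ ((C1 + D) * 2 ^ (-αt) + Q2) * (r ^ αt * K) := by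
    intro x r hr hr2 hx
    obtain ⟨k, hk1, hk2⟩ := scale r hr hr2
    have e1 := L1' x _ hk1
    have e2 := chain (fun j => a x (r * 2 ^ j)) (A := D * (r ^ αt * K)) (q := 2 ^ αt)
      (by positivity) (by positivity) h2αt k ?_
    · have hQK : D * (r ^ αt * K) / (1 - 2 ^ αt) = Q2 * (r ^ αt * K) := by rw [hQ2]; ring
      simp only [hQK, pow_zero, mul_one] at e2
      have e3 : (1 : ℝ) ≤ 2 ^ (-αt) * r ^ αt := by
        have := Real.rpow_le_rpow_of_nonpos hr hr2 hαt₁.le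
        calc (1 : ℝ) = 2 ^ (-αt) * 2 ^ αt := by rw [← Real.rpow_add (by norm_num)]; simp
          _ ≤ _ := by gcongr
      have e4 : (C1 + D) * K ≤ (C1 + D) * 2 ^ (-αt) * (r ^ αt * K) := by
        calc (C1 + D) * K = (C1 + D) * K * 1 := by ring
          _ ≤ (C1 + D) * K * (2 ^ (-αt) * r ^ αt) := by gcongr
          _ = _ := by ring
      rw [add_mul]
      rw [abs_le] at *
      constructor <;> linarith [e1.1, e1.2, e2.1, e2.2]
    · intro j hjk
      have hj : (1 : ℝ) ≤ 2 ^ j := one_le_pow₀ (by norm_num)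
      have hjk2 : (2 : ℝ) ^ (j + 1) ≤ 2 ^ k := pow_le_pow_right₀ (by norm_num) hjk
      have hle : r * 2 ^ (j + 1) ≤ 2 := (mul_le_mul_of_nonneg_left hjk2 hr.le).trans hk2
      have h1 := hstep x x (r * 2 ^ j) (r * 2 ^ (j + 1)) (by positivity) (by positivity)
        (by rw [pow_succ]; nlinarith) (ball_subset_ball (by rw [pow_succ]; nlinarith))
      rw [phi_out hle hx] at h1
      refine h1.trans ?_
      have h3 : (r * 2 ^ (j + 1)) ^ αt ≤ r ^ αt * (2 ^ αt) ^ j := by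
        rw [← two_pow_rpow, ← Real.mul_rpow (by positivity) (by positivity)]
        exact Real.rpow_le_rpow_of_nonpos (by positivity) (by rw [pow_succ]; nlinarith) hαt₁.le
      calc D * ((r * 2 ^ (j + 1)) ^ αt * K) ≤ D * ((r ^ αt * (2 ^ αt) ^ j) * K) := by gcongr
        _ = _ := by ring
  have z3 : 0 ≤ (C1 + D) * 2 ^ (-αt) + Q2 := by positivity
  have z2 : 0 ≤ C1 + D + Q3 := by positivity
  refine ⟨fun x r hr => (L1 x r hr).trans ?_, fun x r h1 h2 h3 => (L2 x r h1 h2 h3).trans ?_,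
    fun x r h1 h2 h3 => (L3 x r h1 h2 h3).trans ?_⟩
  · exact mul_le_mul_of_nonneg_right (by linarith) hK
  · exact mul_le_mul_of_nonneg_right (by linarith) hK
  · exact mul_le_mul_of_nonneg_right (by linarith) (by positivity)

lemma osc_bound {p : ℝ} {φ : EuclideanSpace ℝ (Fin n) → ℝ → ℝ}
    {f : EuclideanSpace ℝ (Fin n) → ℝ} (hφ : ∀ x r, 0 < r → 0 < φ x r)
    (hf : campNorm p φ f < ⊤) (x : EuclideanSpace ℝ (Fin n)) {r : ℝ} (hr : 0 < r) :
    NN (bmu x r) p (fun y => f y - ballAvg f x r) ≤ φ x r * (campNorm p φ f).toReal := by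
  have h1 : ENNReal.ofReal ((φ x r)⁻¹ * NN (bmu x r) p (fun y => f y - ballAvg f x r)) ≤
      campNorm p φ f := by
    refine le_trans ?_ (le_add_right le_rfl : campSemi p φ f ≤ campNorm p φ f)
    rw [campSemi_eq]
    exact le_iSup_of_le x (le_iSup_of_le r (le_iSup_of_le hr le_rfl))
  rw [ENNReal.ofReal_le_iff_le_toReal hf.ne, inv_mul_le_iff₀ (hφ x r hr)] at h1
  exact h1

lemma avg0_bound {p : ℝ} {φ : EuclideanSpace ℝ (Fin n) → ℝ → ℝ}
    {f : EuclideanSpace ℝ (Fin n) → ℝ} 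
    (hf : campNorm p φ f < ⊤) : |ballAvg f 0 1| ≤ (campNorm p φ f).toReal := by
  rw [← ENNReal.ofReal_le_iff_le_toReal hf.ne]
  exact le_add_left le_rfl

lemma phi_pos {a b c : ℝ} (x : EuclideanSpace ℝ (Fin n)) (r : ℝ) (hr : 0 < r) :
    0 < phiEx n a b c x r := by
  unfold phiEx
  split_ifs <;> positivity

end chains

/-- For the specific growth functions `φ` and `ψ` of Section 6, pointwise
multiplication is bounded: `‖fg‖_{𝓛𝓝_{p/2,ψ}} ≤ C ‖f‖_{𝓛𝓝_{p,φ}} ‖g‖_{𝓛𝓝_{p,φ}}`. -/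
theorem product_specific_campanato (n : ℕ) (p α αt β : ℝ) (hp : 2 ≤ p)
    (hαt₀ : -(n : ℝ) / p ≤ αt) (hαt₁ : αt < 0) (hα₀ : 0 < α) (hα₁ : α ≤ 1)
    (hβ₀ : -(n : ℝ) / p ≤ β) (hβ₁ : β < 0) :
    ∃ C > 0, ∀ f g : EuclideanSpace ℝ (Fin n) → ℝ,
      MemLpLoc p f → MemLpLoc p g →
      campNorm p (phiEx n α αt β) f < ⊤ → campNorm p (phiEx n α αt β) g < ⊤ →
        campNorm (p / 2) (phiEx n α (2 * αt) β) (fun x => f x * g x) ≤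
          ENNReal.ofReal C *
            (campNorm p (phiEx n α αt β) f * campNorm p (phiEx n α αt β) g) := by
  obtain ⟨C, hC, hav⟩ := avg_bound_s15 (n := n) (D := 4 ^ n) hαt₁ hα₀ hβ₁ (by positivity)
  have t1 : (1 : ℝ) ≤ 2 ^ α := Real.one_le_rpow (by norm_num) hα₀.le
  set T := (2 : ℝ) ^ α with hT
  refine ⟨2 * (T + 2 * C) + (1 + C) ^ 2, by positivity, ?_⟩
  intro f g mf mg hf hg
  set φ := phiEx n α αt β with hφ
  set K := (campNorm p φ f).toReal with hK
  set L := (campNorm p φ g).toReal with hL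
  have hK0 : 0 ≤ K := ENNReal.toReal_nonneg
  have hL0 : 0 ≤ L := ENNReal.toReal_nonneg
  have hpos : ∀ x r, 0 < r → 0 < φ x r := fun x r hr => phi_pos x r hr
  have hp1 : 1 ≤ p := by linarith
  have of := fun x (r : ℝ) (hr : 0 < r) => osc_bound hpos hf x hr
  have og := fun x (r : ℝ) (hr : 0 < r) => osc_bound hpos hg x hr
  rw [← hK] at of
  rw [← hL] at og
  obtain ⟨f1, f2, f3⟩ := hav (ballAvg f) K hK0 (avg0_bound hf) (fun x y r s hr hs h4 hsub =>
    (avg_diff hp1 mf x y hr hs h4 hsub).trans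
      (mul_le_mul_of_nonneg_left (of y s hs) (by positivity)))
  obtain ⟨g1, g2, g3⟩ := hav (ballAvg g) L hL0 (avg0_bound hg) (fun x y r s hr hs h4 hsub =>
    (avg_diff hp1 mg x y hr hs h4 hsub).trans
      (mul_le_mul_of_nonneg_left (og y s hs) (by positivity)))
  have key : ∀ (Φ S : ℝ) x r, 0 < r → φ x r = Φ → |ballAvg f x r| ≤ C * (S * K) →
      |ballAvg g x r| ≤ C * (S * L) → 0 ≤ S →
      NN (bmu x r) (p / 2) (fun y => f y * g y - ballAvg (fun y => f y * g y) x r) ≤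
        2 * (Φ ^ 2 + 2 * C * (S * Φ)) * (K * L) := by
    intro Φ S x r hr hΦ bf bg hS
    have := bmu_prob x hr
    have hk := (NN_prod (bmu x r) hp (memLp_bmu hp1 mf x hr) (memLp_bmu hp1 mg x hr)
      (ballAvg f x r) (ballAvg g x r)).1
    rw [ballAvg_eq (fun y => f y * g y)]
    refine hk.trans ?_
    have a1 := of x r hr
    have a2 := og x r hr
    have hΦ0 := hpos x r hr
    rw [hΦ] at a1 a2 hΦ0
    have b1 := mul_le_mul a1 a2 (NN_nonneg _ _ _) (by positivity)
    have b2 := mul_le_mul bf a2 (NN_nonneg _ _ _) (by positivity)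
    have b3 := mul_le_mul bg a1 (NN_nonneg _ _ _) (by positivity)
    have : 2 * (Φ ^ 2 + 2 * C * (S * Φ)) * (K * L) =
      2 * (Φ * K * (Φ * L) + C * (S * K) * (Φ * L) + C * (S * L) * (Φ * K)) := by ring
    rw [this]
    linarith
  have semi : campSemi (p / 2) (phiEx n α (2 * αt) β) (fun x => f x * g x) ≤
      ENNReal.ofReal (2 * (T + 2 * C) * (K * L)) := by
    rw [campSemi_eq]
    refine iSup_le fun x => iSup_le fun r => iSup_le fun hr => ENNReal.ofReal_le_ofReal ?_
    have hψ := phi_pos (a := α) (b := 2 * αt) (c := β) x r hr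
    rw [inv_mul_le_iff₀ hψ]
    have hKL : 0 ≤ K * L := by positivity
    by_cases hr2 : r ≤ 2
    · by_cases hx : ‖x‖ ≤ 2
      · refine (key (r ^ α) 1 x r hr (phi_in hr2 hx) (by simpa using f2 x r hr hr2 hx)
          (by simpa using g2 x r hr hr2 hx) zero_le_one).trans ?_
        rw [phi_in hr2 hx]
        have h1 : r ^ α ≤ T := Real.rpow_le_rpow hr.le hr2 hα₀.le
        have h0 : 0 < r ^ α := by positivity
        calc 2 * ((r ^ α) ^ 2 + 2 * C * (1 * r ^ α)) * (K * L)
            = r ^ α * (2 * (r ^ α + 2 * C) * (K * L)) := by ring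
          _ ≤ _ := by gcongr
      · have hx := not_le.1 hx
        refine (key (r ^ αt) (r ^ αt) x r hr (phi_out hr2 hx) (f3 x r hr hr2 hx)
          (g3 x r hr hr2 hx) (by positivity)).trans ?_
        rw [phi_out hr2 hx]
        have h1 : r ^ (2 * αt) = (r ^ αt) ^ 2 := by
          rw [mul_comm, Real.rpow_mul hr.le]; norm_num
        have h0 : 0 < r ^ αt := by positivity
        rw [h1]
        calc 2 * ((r ^ αt) ^ 2 + 2 * C * (r ^ αt * r ^ αt)) * (K * L)
            = (r ^ αt) ^ 2 * (2 * (1 + 2 * C) * (K * L)) := by ring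
          _ ≤ _ := by gcongr
    · have hr2 := not_le.1 hr2
      refine (key (r ^ β) 1 x r hr (phi_big x hr2) (by simpa using f1 x r hr2)
          (by simpa using g1 x r hr2) zero_le_one).trans ?_
      rw [phi_big x hr2]
      have h1 : r ^ β ≤ T :=
        (Real.rpow_le_one_of_one_le_of_nonpos (by linarith) hβ₁.le).trans t1
      have h0 : 0 < r ^ β := by positivity
      calc 2 * ((r ^ β) ^ 2 + 2 * C * (1 * r ^ β)) * (K * L)
            = r ^ β * (2 * (r ^ β + 2 * C) * (K * L)) := by ring
          _ ≤ _ := by gcongr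
  have av : |ballAvg (fun x => f x * g x) 0 1| ≤ (1 + C) ^ 2 * (K * L) := by
    have := bmu_prob (0 : EuclideanSpace ℝ (Fin n)) one_pos
    have hk := (NN_prod (bmu 0 1) hp (memLp_bmu hp1 mf 0 one_pos) (memLp_bmu hp1 mg 0 one_pos)
      (ballAvg f 0 1) (ballAvg g 0 1)).2
    rw [ballAvg_eq (fun y => f y * g y)]
    refine hk.trans ?_
    have a1 := of 0 1 one_pos
    have a2 := og 0 1 one_pos
    have e : φ 0 1 = 1 := by rw [hφ, phi_in (by norm_num) (by simp)]; simp
    rw [e, one_mul] at a1 a2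
    have bf := f2 0 1 one_pos (by norm_num) (by simp)
    have bg := g2 0 1 one_pos (by norm_num) (by simp)
    have b1 := mul_le_mul a1 a2 (NN_nonneg _ _ _) (by positivity)
    have b2 := mul_le_mul bf a2 (NN_nonneg _ _ _) (by positivity)
    have b3 := mul_le_mul bg a1 (NN_nonneg _ _ _) (by positivity)
    have b4 := mul_le_mul bf bg (abs_nonneg _) (by positivity)
    have : (1 + C) ^ 2 * (K * L) = K * L + C * K * L + C * L * K + C * K * (C * L) := by ring
    rw [this]
    linarith
  have hKe : campNorm p φ f = ENNReal.ofReal K := (ENNReal.ofReal_toReal hf.ne).symm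
  have hLe : campNorm p φ g = ENNReal.ofReal L := (ENNReal.ofReal_toReal hg.ne).symm
  rw [hKe, hLe, ← ENNReal.ofReal_mul hK0, ← ENNReal.ofReal_mul (by positivity), add_mul,
    ENNReal.ofReal_add (by positivity) (by positivity)]
  exact add_le_add semi (ENNReal.ofReal_le_ofReal av)

end
end

section
/- Let n ≥ 2, 0 < α < 1, and let p, β satisfy one of: (2 < p < n and −1 ≤ β < 0), or (p = n and −1 < β < 0), or (n < p and −n/p ≤ β < 0); let −n/p ≤ α̃ < 0 and define φ(x,r) = r^α if |x| ≤ 2 and 0 < r ≤ 2, φ(x,r) = r^{α̃} if |x| > 2 and 0 < r ≤ 2, φ(x,r) = r^β if r > 2. Suppose f : ℝⁿ → ℝ is α-Hölder continuous on the ball B(0,4) (i.e. |f(x) − f(y)| ≤ L|x − y|^α for x, y ∈ B(0,4)) and satisfies |f(x)| ≤ C₀/|x| for |x| ≥ 2. Then ‖f‖_{𝓛𝓝_{p,φ}} < ∞, i.e. f belongs to the Campanato space 𝓛𝓝_{p,φ}(ℝⁿ), and moreover σ(f) = lim_{r→∞} f_{B(0,r)} = 0. -/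
open MeasureTheory Metric Filter
open scoped ENNReal NNReal

noncomputable section

lemma aux_vol {n : ℕ} (hn : 2 ≤ n) (x : EuclideanSpace ℝ (Fin n)) {r : ℝ} (hr : 0 < r) :
    (volume (ball x r)).toReal = r ^ (n : ℝ) * (volume (ball (0 : EuclideanSpace ℝ (Fin n)) 1)).toReal := by
  rw [Measure.addHaar_ball_of_pos _ _ hr]
  simp [ENNReal.toReal_mul, ENNReal.toReal_ofReal, hr.le]

lemma aux_vol_pos {n : ℕ} (x : EuclideanSpace ℝ (Fin n)) {r : ℝ} (hr : 0 < r) :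
    0 < (volume (ball x r)).toReal :=
  ENNReal.toReal_pos (measure_ball_pos _ _ hr).ne' measure_ball_lt_top.ne

lemma aux_mean {n : ℕ} (x : EuclideanSpace ℝ (Fin n)) {r : ℝ} (hr : 0 < r)
    (g : EuclideanSpace ℝ (Fin n) → ℝ) (D : ℝ) (h : ∀ y ∈ ball x r, |g y| ≤ D) :
    |(volume (ball x r)).toReal⁻¹ * ∫ y in ball x r, g y| ≤ D := by
  have hv := aux_vol_pos x hr
  have := norm_setIntegral_le_of_norm_le_const (μ := volume) (s := ball x r) (f := g) (C := D)
    measure_ball_lt_top (fun y hy => by simpa using h y hy)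
  rw [abs_mul, abs_of_pos (inv_pos.2 hv), inv_mul_le_iff₀ hv, mul_comm]
  simpa [Measure.real] using this

lemma aux_meanp {n : ℕ} (x : EuclideanSpace ℝ (Fin n)) {r p : ℝ} (hr : 0 < r) (hp : 0 < p)
    (g : EuclideanSpace ℝ (Fin n) → ℝ) (D : ℝ) (h : ∀ y ∈ ball x r, |g y| ≤ D) :
    ((volume (ball x r)).toReal⁻¹ * ∫ y in ball x r, |g y| ^ p) ^ (1 / p) ≤ D := by
  have hD : 0 ≤ D := (abs_nonneg _).trans (h x (mem_ball_self hr))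
  have h1 : |(volume (ball x r)).toReal⁻¹ * ∫ y in ball x r, |g y| ^ p| ≤ D ^ p := by
    apply aux_mean x hr
    intro y hy
    rw [abs_of_nonneg (by positivity)]
    exact Real.rpow_le_rpow (abs_nonneg _) (h y hy) hp.le
  have h0 : 0 ≤ (volume (ball x r)).toReal⁻¹ * ∫ y in ball x r, |g y| ^ p := by
    have : 0 ≤ ∫ y in ball x r, |g y| ^ p := integral_nonneg fun y => by positivity
    positivity
  rw [abs_of_nonneg h0] at h1
  calc _ ≤ (D ^ p) ^ (1 / p) := Real.rpow_le_rpow h0 h1 (by positivity)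
    _ = D := by rw [← Real.rpow_mul hD, mul_one_div_cancel hp.ne', Real.rpow_one]

lemma aux_sub {n : ℕ} (x : EuclideanSpace ℝ (Fin n)) {r : ℝ} (hr : 0 < r)
    (f : EuclideanSpace ℝ (Fin n) → ℝ) (hf : IntegrableOn f (ball x r)) (c D : ℝ)
    (h : ∀ y ∈ ball x r, |c - f y| ≤ D) : |c - ballAvg f x r| ≤ D := by
  have hv := aux_vol_pos x hr
  have h1 := aux_mean x hr (fun y => c - f y) D h
  have hc : IntegrableOn (fun _ : EuclideanSpace ℝ (Fin n) => c) (ball x r) :=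
    integrableOn_const measure_ball_lt_top.ne
  rw [integral_sub hc hf] at h1
  have : ∫ y in ball x r, c = (volume (ball x r)).toReal * c := by
    simp [Measure.real]
  rw [this, mul_sub, inv_mul_cancel_left₀ hv.ne'] at h1
  exact h1

lemma aux_jensen {n : ℕ} (x : EuclideanSpace ℝ (Fin n)) {r p : ℝ} (hr : 0 < r) (hp : 1 ≤ p)
    (f : EuclideanSpace ℝ (Fin n) → ℝ) (hf : IntegrableOn f (ball x r))
    (hfp : IntegrableOn (fun y => |f y| ^ p) (ball x r)) :
    |ballAvg f x r| ^ p ≤ (volume (ball x r)).toReal⁻¹ * ∫ y in ball x r, |f y| ^ p := by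
  have hv := aux_vol_pos x hr
  have h1 : |ballAvg f x r| ≤ (volume (ball x r)).toReal⁻¹ * ∫ y in ball x r, |f y| := by
    unfold ballAvg
    rw [abs_mul, abs_of_pos (inv_pos.2 hv)]
    gcongr
    exact abs_integral_le_integral_abs
  have h2 := ConvexOn.map_set_average_le (μ := volume) (t := ball x r) (f := fun y => |f y|)
    (convexOn_rpow hp) (Real.continuous_rpow_const (by linarith)).continuousOn isClosed_Ici
    (measure_ball_pos _ _ hr).ne' measure_ball_lt_top.ne
    (Eventually.of_forall fun y => abs_nonneg (f y)) hf.abs hfp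
  rw [setAverage_eq, setAverage_eq] at h2
  simp only [smul_eq_mul, Measure.real] at h2
  exact (Real.rpow_le_rpow (abs_nonneg _) h1 (by linarith)).trans h2

lemma aux_campanato {n : ℕ} (x : EuclideanSpace ℝ (Fin n)) {r p : ℝ} (hr : 0 < r) (hp : 1 ≤ p)
    (f : EuclideanSpace ℝ (Fin n) → ℝ) (hf : IntegrableOn f (ball x r))
    (hfp : IntegrableOn (fun y => |f y| ^ p) (ball x r)) :
    (volume (ball x r)).toReal⁻¹ * ∫ y in ball x r, |f y - ballAvg f x r| ^ p ≤
      2 ^ p * ((volume (ball x r)).toReal⁻¹ * ∫ y in ball x r, |f y| ^ p) := by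
  have hv := aux_vol_pos x hr
  have hJ := aux_jensen x hr hp f hf hfp
  set A := ballAvg f x r
  have hpt : ∀ y, |f y - A| ^ p ≤ 2 ^ (p - 1) * (|f y| ^ p + |A| ^ p) := by
    intro y
    have h1 : |f y - A| ^ p ≤ (|f y| + |A|) ^ p :=
      Real.rpow_le_rpow (abs_nonneg _) (abs_sub _ _) (by linarith)
    have h2 := NNReal.rpow_add_le_mul_rpow_add_rpow ⟨|f y|, abs_nonneg _⟩ ⟨|A|, abs_nonneg _⟩ hp
    exact h1.trans (by exact_mod_cast h2)
  have hc : IntegrableOn (fun _ : EuclideanSpace ℝ (Fin n) => |A| ^ p) (ball x r) :=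
    integrableOn_const measure_ball_lt_top.ne
  have hI : ∫ y in ball x r, |f y - A| ^ p ≤ ∫ y in ball x r, 2 ^ (p - 1) * (|f y| ^ p + |A| ^ p) := by
    apply integral_mono_of_nonneg (Eventually.of_forall fun y => by positivity)
    · exact (hfp.add hc).const_mul _
    · exact Eventually.of_forall hpt
  rw [integral_const_mul, integral_add hfp hc] at hI
  have : ∫ y in ball x r, |A| ^ p = (volume (ball x r)).toReal * |A| ^ p := by
    simp [Measure.real]
  rw [this] at hI
  have h2p : (2 : ℝ) ^ p = 2 ^ (p - 1) * 2 := by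
    rw [← Real.rpow_add_one (by norm_num)]; congr 1; ring
  calc _ ≤ (volume (ball x r)).toReal⁻¹ * (2 ^ (p - 1) * ((∫ y in ball x r, |f y| ^ p) +
        (volume (ball x r)).toReal * |A| ^ p)) := by gcongr
    _ = 2 ^ (p - 1) * ((volume (ball x r)).toReal⁻¹ * (∫ y in ball x r, |f y| ^ p) + |A| ^ p) := by
        field_simp
    _ ≤ 2 ^ (p - 1) * ((volume (ball x r)).toReal⁻¹ * (∫ y in ball x r, |f y| ^ p) +
        (volume (ball x r)).toReal⁻¹ * (∫ y in ball x r, |f y| ^ p)) := by gcongr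
    _ = _ := by rw [h2p]; ring

lemma aux_riesz {n : ℕ} (hn : 2 ≤ n) {s : ℝ} (hs : s < n) : ∃ C : ℝ, 0 ≤ C ∧ ∀ r : ℝ, 0 < r →
    IntegrableOn (fun y : EuclideanSpace ℝ (Fin n) => ‖y‖ ^ (-s)) (ball 0 r) ∧
    ∫ y in ball (0 : EuclideanSpace ℝ (Fin n)) r, ‖y‖ ^ (-s) ≤ C * r ^ ((n : ℝ) - s) := by
  have : Nonempty (Fin n) := ⟨⟨0, by omega⟩⟩
  set c := (volume (ball (0 : EuclideanSpace ℝ (Fin n)) 1)).toReal with hcdef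
  have hc : 0 < c := aux_vol_pos _ one_pos
  have hns : 0 < (n : ℝ) - s := by linarith
  refine ⟨n * (c * (1 / ((n : ℝ) - s))), by positivity, fun r hr => ?_⟩
  have heq : ∀ y ∈ Set.Ioo 0 r, y ^ (n - 1) • y ^ (-s) = y ^ ((n : ℝ) - s - 1) := by
    intro y hy
    rw [smul_eq_mul, ← Real.rpow_natCast, ← Real.rpow_add hy.1, Nat.cast_sub (by omega)]
    congr 1; push_cast; ring
  have hi := intervalIntegral.intervalIntegrable_rpow' (a := 0) (b := r)
    (r := (n : ℝ) - s - 1) (by linarith)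
  have hint : ∫ y in (0:ℝ)..r, y ^ ((n : ℝ) - s - 1) = r ^ ((n : ℝ) - s) / ((n : ℝ) - s) := by
    rw [integral_rpow (Or.inl (by linarith))]
    simp [Real.zero_rpow hns.ne']
  rw [intervalIntegrable_iff_integrableOn_Ioo_of_le hr.le] at hi
  rw [intervalIntegral.integral_of_le hr.le, integral_Ioc_eq_integral_Ioo] at hint
  constructor
  · rw [integrableOn_fun_norm_addHaar volume (f := fun t => t ^ (-s))]
    simp only [finrank_euclideanSpace, Fintype.card_fin]
    exact hi.congr_fun (fun y hy => (heq y hy).symm) measurableSet_Ioo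
  · apply le_of_eq
    have h1 := integral_fun_norm_addHaar (volume : Measure (EuclideanSpace ℝ (Fin n)))
      ((Set.Iio r).indicator fun t : ℝ => t ^ (-s))
    have h2 : (fun x : EuclideanSpace ℝ (Fin n) => (Set.Iio r).indicator (fun t : ℝ => t ^ (-s)) ‖x‖)
        = (ball 0 r).indicator fun x => ‖x‖ ^ (-s) := by
      ext x; simp [Set.indicator]
    rw [h2, integral_indicator measurableSet_ball] at h1
    rw [h1]
    simp only [finrank_euclideanSpace, Fintype.card_fin]
    have h3 : ∫ y in Set.Ioi (0:ℝ), y ^ (n - 1) • (Set.Iio r).indicator (fun t : ℝ => t ^ (-s)) y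
        = ∫ y in Set.Ioo 0 r, y ^ ((n : ℝ) - s - 1) := by
      rw [← integral_indicator measurableSet_Ioo, ← integral_indicator measurableSet_Ioi]
      congr 1
      ext y
      by_cases h0 : 0 < y
      · by_cases h1 : y < r
        · have := heq y ⟨h0, h1⟩
          simp [h0, h1] at this ⊢
          exact this
        · simp [h0, h1]
      · simp [h0]
    rw [h3, hint, nsmul_eq_mul, smul_eq_mul, Measure.real, ← hcdef]
    field_simp

/-- bound of the `p`-mean over large balls -/
lemma aux_big {n : ℕ} (hn : 2 ≤ n) {p β K : ℝ} (hp : 2 ≤ p) (hK : 0 ≤ K)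
    (hcase : (2 < p ∧ p < (n : ℝ) ∧ -1 ≤ β ∧ β < 0) ∨
             (p = (n : ℝ) ∧ -1 < β ∧ β < 0) ∨
             ((n : ℝ) < p ∧ -(n : ℝ) / p ≤ β ∧ β < 0))
    (f : EuclideanSpace ℝ (Fin n) → ℝ)
    (hf : ∀ y, |f y| ≤ K / (1 + ‖y‖)) :
    ∃ C : ℝ, 0 ≤ C ∧ ∀ (x : EuclideanSpace ℝ (Fin n)) (r : ℝ), 1 ≤ r →
      (volume (ball x r)).toReal⁻¹ * ∫ y in ball x r, |f y| ^ p ≤ C * r ^ (β * p) := by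
  have : Nonempty (Fin n) := ⟨⟨0, by omega⟩⟩
  set c := (volume (ball (0 : EuclideanSpace ℝ (Fin n)) 1)).toReal with hcdef
  have hc : 0 < c := aux_vol_pos _ one_pos
  have hp0 : 0 < p := by linarith
  have hfp : ∀ y, |f y| ^ p ≤ K ^ p * (1 + ‖y‖) ^ (-p) := by
    intro y
    have h1 : 0 < 1 + ‖y‖ := by positivity
    calc _ ≤ (K / (1 + ‖y‖)) ^ p := Real.rpow_le_rpow (abs_nonneg _) (hf y) hp0.le
      _ = _ := by rw [Real.div_rpow hK h1.le, Real.rpow_neg h1.le]; rfl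
  have main : (((n : ℝ) < p ∧ -(n : ℝ) / p ≤ β)) ∨ (0 < -(β * p) ∧ -(β * p) < n ∧ -(β * p) ≤ p) := by
    rcases hcase with h | h | h
    · right; refine ⟨by nlinarith, by nlinarith, by nlinarith⟩
    · right; refine ⟨by nlinarith, by nlinarith, by nlinarith⟩
    · left; exact ⟨h.1, h.2.1⟩
  rcases main with ⟨h1, h2⟩ | ⟨h1, h2, h3⟩
  · have hint : Integrable (fun y : EuclideanSpace ℝ (Fin n) => (1 + ‖y‖) ^ (-p)) volume :=
      integrable_one_add_norm (by simpa using h1)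
    have hI0 : 0 ≤ ∫ y : EuclideanSpace ℝ (Fin n), (1 + ‖y‖) ^ (-p) :=
      integral_nonneg fun y => by positivity
    refine ⟨c⁻¹ * (K ^ p * ∫ y : EuclideanSpace ℝ (Fin n), (1 + ‖y‖) ^ (-p)), by positivity, ?_⟩
    intro x r hr
    have hr0 : 0 < r := by linarith
    have hI : ∫ y in ball x r, |f y| ^ p ≤ K ^ p * ∫ y : EuclideanSpace ℝ (Fin n), (1 + ‖y‖) ^ (-p) := by
      calc _ ≤ ∫ y in ball x r, K ^ p * (1 + ‖y‖) ^ (-p) := by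
            apply integral_mono_of_nonneg (Eventually.of_forall fun y => by positivity)
            · exact (hint.const_mul _).integrableOn
            · exact Eventually.of_forall hfp
        _ ≤ ∫ y, K ^ p * (1 + ‖y‖) ^ (-p) :=
            setIntegral_le_integral (hint.const_mul _) (Eventually.of_forall fun y => by positivity)
        _ = _ := integral_const_mul _ _
    have hrr : r ^ (-(n : ℝ)) ≤ r ^ (β * p) := by
      apply Real.rpow_le_rpow_of_exponent_le hr
      rwa [div_le_iff₀ hp0] at h2
    rw [aux_vol hn x hr0, mul_inv, ← Real.rpow_neg hr0.le, ← hcdef]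
    calc _ ≤ (r ^ (β * p) * c⁻¹) * (K ^ p * ∫ y : EuclideanSpace ℝ (Fin n), (1 + ‖y‖) ^ (-p)) := by
          gcongr
      _ = _ := by ring
  · set s := -(β * p) with hs
    obtain ⟨C, hC, hR⟩ := aux_riesz hn h2
    refine ⟨K ^ p * (1 + c⁻¹ * C), by positivity, ?_⟩
    intro x r hr
    have hr0 : 0 < r := by linarith
    obtain ⟨hi, hle⟩ := hR r hr0
    have hv := aux_vol_pos x hr0
    have hbp : β * p = -s := by rw [hs]; ring
    have hconst : IntegrableOn (fun _ : EuclideanSpace ℝ (Fin n) => r ^ (-s)) (ball x r) :=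
      integrableOn_const measure_ball_lt_top.ne
    have hind := (integrable_indicator_iff (μ := volume)
      (measurableSet_ball (x := (0 : EuclideanSpace ℝ (Fin n))) (ε := r))).2 hi
    have hI : ∫ y in ball x r, |f y| ^ p ≤ ∫ y in ball x r, K ^ p * (r ^ (-s) +
        (ball (0 : EuclideanSpace ℝ (Fin n)) r).indicator (fun y => ‖y‖ ^ (-s)) y) := by
      apply integral_mono_of_nonneg (Eventually.of_forall fun y => by positivity)
      · exact (hconst.add hind.integrableOn).const_mul _
      · have h0 : ∀ᵐ y ∂(volume.restrict (ball x r)), y ≠ (0 : EuclideanSpace ℝ (Fin n)) := by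
          apply ae_restrict_of_ae
          simp [ae_iff]
        filter_upwards [h0] with y hy
        have hy0 : 0 < ‖y‖ := norm_pos_iff.2 hy
        refine (hfp y).trans ?_
        gcongr
        have e1 : (1 + ‖y‖) ^ (-p) ≤ (1 + ‖y‖) ^ (-s) :=
          Real.rpow_le_rpow_of_exponent_le (by linarith) (by linarith)
        have e2 : (1 + ‖y‖) ^ (-s) ≤ ‖y‖ ^ (-s) :=
          Real.rpow_le_rpow_of_nonpos hy0 (by linarith) (by linarith)
        have e3 : 0 ≤ r ^ (-s) := by positivity
        by_cases hyr : ‖y‖ < r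
        · simp [hyr]; linarith
        · have e4 : ‖y‖ ^ (-s) ≤ r ^ (-s) :=
            Real.rpow_le_rpow_of_nonpos hr0 (by linarith) (by linarith)
          simp [hyr]; linarith
    rw [integral_const_mul, integral_add hconst hind.integrableOn] at hI
    have e1 : ∫ y in ball x r, r ^ (-s) = (volume (ball x r)).toReal * r ^ (-s) := by
      simp [Measure.real]
    have e2 : ∫ y in ball x r, (ball (0 : EuclideanSpace ℝ (Fin n)) r).indicator
        (fun y => ‖y‖ ^ (-s)) y ≤ C * r ^ ((n : ℝ) - s) := by
      refine (setIntegral_le_integral hind (Eventually.of_forall fun y => ?_)).trans ?_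
      · exact Set.indicator_nonneg (fun y _ => by positivity) y
      · rw [integral_indicator measurableSet_ball]; exact hle
    have hV := aux_vol hn x hr0
    rw [← hcdef] at hV
    calc _ ≤ (volume (ball x r)).toReal⁻¹ * (K ^ p * ((volume (ball x r)).toReal * r ^ (-s) +
          C * r ^ ((n : ℝ) - s))) := by
          gcongr
          refine hI.trans ?_
          rw [e1]; gcongr
      _ = K ^ p * (r ^ (-s) + (volume (ball x r)).toReal⁻¹ * (C * r ^ ((n : ℝ) - s))) := by
          field_simp
      _ = _ := by
          have hrn : 0 < r ^ (n : ℝ) := by positivity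
          rw [hV, hbp, sub_eq_add_neg, Real.rpow_add hr0]
          field_simp

/-- If `f` is `α`-Hölder continuous on `B(0,4)` and `|f(x)| ≤ C₀/|x|` for
`|x| ≥ 2`, then `f` belongs to the Campanato space `𝓛𝓝_{p,φ}` for the specific growth
function `φ` of Section 6, and `σ(f) = lim_{r→∞} f_{B(0,r)} = 0`. -/
theorem holder_decay_mem_campanato (n : ℕ) (hn : 2 ≤ n) (p α αt β : ℝ)
    (hα₀ : 0 < α) (hα₁ : α < 1)
    (hcase : (2 < p ∧ p < (n : ℝ) ∧ -1 ≤ β ∧ β < 0) ∨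
             (p = (n : ℝ) ∧ -1 < β ∧ β < 0) ∨
             ((n : ℝ) < p ∧ -(n : ℝ) / p ≤ β ∧ β < 0))
    (hαt₀ : -(n : ℝ) / p ≤ αt) (hαt₁ : αt < 0)
    (f : EuclideanSpace ℝ (Fin n) → ℝ) (hfm : Measurable f)
    (L : ℝ)
    (hHol : ∀ x ∈ ball (0 : EuclideanSpace ℝ (Fin n)) 4,
      ∀ y ∈ ball (0 : EuclideanSpace ℝ (Fin n)) 4, |f x - f y| ≤ L * dist x y ^ α)
    (C₀ : ℝ)
    (hdecay : ∀ x : EuclideanSpace ℝ (Fin n), 2 ≤ ‖x‖ → |f x| ≤ C₀ / ‖x‖) :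
    campNorm p (phiEx n α αt β) f < ⊤ ∧
    Tendsto (fun r => ballAvg f 0 r) atTop (nhds 0) := by
  have hn' : (2 : ℝ) ≤ n := by exact_mod_cast hn
  have hp : 2 ≤ p := by rcases hcase with h | h | h <;> linarith [h.1]
  have hp0 : 0 < p := by linarith
  have hβ : β < 0 := by
    rcases hcase with h | h | h
    · exact h.2.2.2
    · exact h.2.2
    · exact h.2.2
  -- global bound
  obtain ⟨K, hK, hfK⟩ : ∃ K : ℝ, 0 ≤ K ∧ ∀ y, |f y| ≤ K / (1 + ‖y‖) := by
    set M := |f 0| + |L| * 4 ^ α with hM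
    have hM0 : 0 ≤ M := by positivity
    refine ⟨5 * M + 2 * |C₀|, by positivity, fun y => ?_⟩
    have h1 : 0 < 1 + ‖y‖ := by positivity
    rw [le_div_iff₀ h1]
    by_cases hy : ‖y‖ < 4
    · have h2 := hHol y (by simpa using hy) 0 (by simp)
      have h3 : L * dist y 0 ^ α ≤ |L| * 4 ^ α := by
        rw [dist_zero_right]
        have : ‖y‖ ^ α ≤ 4 ^ α := Real.rpow_le_rpow (norm_nonneg _) hy.le hα₀.le
        have h0 : 0 ≤ ‖y‖ ^ α := by positivity
        calc L * ‖y‖ ^ α ≤ |L| * ‖y‖ ^ α := by gcongr; exact le_abs_self L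
          _ ≤ _ := by gcongr
      have h4 : |f y| ≤ M := by
        have := abs_sub_abs_le_abs_sub (f y) (f 0)
        linarith
      have := abs_nonneg C₀
      nlinarith [abs_nonneg (f y), norm_nonneg y]
    · push Not at hy
      have h2 := hdecay y (by linarith)
      have hy0 : 0 < ‖y‖ := by linarith
      rw [le_div_iff₀ hy0] at h2
      nlinarith [abs_nonneg (f y), le_abs_self C₀]
  have hfK' : ∀ y, |f y| ≤ K := fun y => (hfK y).trans
    (div_le_self hK (by linarith [norm_nonneg y]))
  have hint : ∀ x r, IntegrableOn f (ball x r) := fun x r =>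
    Measure.integrableOn_of_bounded (M := K) measure_ball_lt_top.ne hfm.aestronglyMeasurable
      (Eventually.of_forall hfK')
  have hintp : ∀ x r, IntegrableOn (fun y => |f y| ^ p) (ball x r) := fun x r =>
    Measure.integrableOn_of_bounded (M := K ^ p) measure_ball_lt_top.ne
      ((measurable_norm.comp hfm).pow_const p).aestronglyMeasurable
      (Eventually.of_forall fun y => by
        rw [Real.norm_of_nonneg (by positivity)]
        exact Real.rpow_le_rpow (abs_nonneg _) (hfK' y) hp0.le)
  obtain ⟨C, hC, hbig⟩ := aux_big hn hp hK hcase f hfK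
  have hroot : ∀ r : ℝ, 0 < r → (C * r ^ (β * p)) ^ (1 / p) = C ^ (1 / p) * r ^ β := by
    intro r hr
    rw [Real.mul_rpow hC (by positivity), ← Real.rpow_mul hr.le]
    congr 2
    field_simp
  constructor
  · have hsemi : campSemi p (phiEx n α αt β) f ≤ ENNReal.ofReal
        (|L| * 2 ^ α + 2 ^ (-αt) * (2 * K) + 2 * C ^ (1 / p)) := by
      unfold campSemi
      refine iSup_le fun x => iSup_le fun r => iSup_le fun hr => ENNReal.ofReal_le_ofReal ?_
      have t1 : 0 ≤ |L| * 2 ^ α := by positivity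
      have t2 : 0 ≤ 2 ^ (-αt) * (2 * K) := by positivity
      have t3 : 0 ≤ 2 * C ^ (1 / p) := by positivity
      unfold phiEx
      split_ifs with h1 h2
      · have hsub : ∀ y ∈ ball x r, y ∈ ball (0 : EuclideanSpace ℝ (Fin n)) 4 := by
          intro y hy
          have a1 := dist_triangle y x 0
          rw [mem_ball] at hy ⊢
          rw [dist_zero_right x] at a1
          linarith
        have := aux_meanp x hr hp0 (fun y => f y - ballAvg f x r) (|L| * (2 * r) ^ α) (by
          intro y hy
          apply aux_sub x hr f (hint x r)
          intro z hz
          refine (hHol y (hsub y hy) z (hsub z hz)).trans ?_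
          have a1 := dist_triangle_right y z x
          rw [mem_ball] at hy hz
          have : dist y z ^ α ≤ (2 * r) ^ α :=
            Real.rpow_le_rpow dist_nonneg (by linarith) hα₀.le
          have h0 : 0 ≤ dist y z ^ α := by positivity
          calc _ ≤ |L| * dist y z ^ α := by gcongr; exact le_abs_self L
            _ ≤ _ := by gcongr)
        have hrα : 0 < r ^ α := by positivity
        rw [Real.mul_rpow (by norm_num) hr.le] at this
        have h5 : (r ^ α)⁻¹ * ((volume (ball x r)).toReal⁻¹ *
            ∫ y in ball x r, |f y - ballAvg f x r| ^ p) ^ (1 / p) ≤ |L| * 2 ^ α := by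
          rw [inv_mul_le_iff₀ hrα]
          linarith
        linarith
      · have := aux_meanp x hr hp0 (fun y => f y - ballAvg f x r) (2 * K) (by
          intro y hy
          apply aux_sub x hr f (hint x r)
          intro z hz
          have := abs_sub (f y) (f z)
          linarith [hfK' y, hfK' z])
        rw [← Real.rpow_neg hr.le]
        have h4 : r ^ (-αt) ≤ 2 ^ (-αt) := Real.rpow_le_rpow hr.le h1 (by linarith)
        have h5 : r ^ (-αt) * ((volume (ball x r)).toReal⁻¹ *
            ∫ y in ball x r, |f y - ballAvg f x r| ^ p) ^ (1 / p) ≤ 2 ^ (-αt) * (2 * K) := by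
          gcongr
        linarith
      · push Not at h1
        have hrβ : 0 < r ^ β := by positivity
        have a1 := aux_campanato x hr (by linarith) f (hint x r) (hintp x r)
        have a2 := hbig x r (by linarith)
        have h0 : 0 ≤ (volume (ball x r)).toReal⁻¹ *
            ∫ y in ball x r, |f y - ballAvg f x r| ^ p := by
          have : 0 ≤ ∫ y in ball x r, |f y - ballAvg f x r| ^ p :=
            integral_nonneg fun y => by positivity
          positivity
        have a3 : ((volume (ball x r)).toReal⁻¹ *
            ∫ y in ball x r, |f y - ballAvg f x r| ^ p) ^ (1 / p) ≤ 2 * (C ^ (1 / p) * r ^ β) := by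
          calc _ ≤ (2 ^ p * (C * r ^ (β * p))) ^ (1 / p) := by
                apply Real.rpow_le_rpow h0 _ (by positivity)
                refine a1.trans ?_
                gcongr
            _ = _ := by
                rw [Real.mul_rpow (by positivity) (by positivity), hroot r hr,
                  ← Real.rpow_mul (by norm_num), mul_one_div_cancel hp0.ne', Real.rpow_one]
        have h5 : (r ^ β)⁻¹ * ((volume (ball x r)).toReal⁻¹ *
            ∫ y in ball x r, |f y - ballAvg f x r| ^ p) ^ (1 / p) ≤ 2 * C ^ (1 / p) := by
          rw [inv_mul_le_iff₀ hrβ]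
          linarith
        linarith
    unfold campNorm
    exact ENNReal.add_lt_top.2 ⟨hsemi.trans_lt ENNReal.ofReal_lt_top, ENNReal.ofReal_lt_top⟩
  · have hlim : Tendsto (fun r : ℝ => C ^ (1 / p) * r ^ β) atTop (nhds 0) := by
      have := (tendsto_rpow_neg_atTop (y := -β) (by linarith)).const_mul (C ^ (1 / p))
      simpa using this
    apply squeeze_zero_norm' _ hlim
    filter_upwards [eventually_ge_atTop 1] with r hr
    have hr0 : 0 < r := by linarith
    have a1 := aux_jensen 0 hr0 (by linarith) f (hint 0 r) (hintp 0 r)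
    have a2 := a1.trans (hbig 0 r hr)
    have a3 := Real.rpow_le_rpow (by positivity) a2 (show 0 ≤ 1 / p by positivity)
    rw [hroot r hr0, ← Real.rpow_mul (abs_nonneg _), mul_one_div_cancel hp0.ne', Real.rpow_one] at a3
    simpa using a3

end
end
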